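/- Let m and n be positive integers with m ≤ n and let ℓ₁ and ℓ₂ be positive definite even integral quadratic forms of rank m. Then the pair (ℓ₁, ℓ₂) is buried in rank n over ℚ_p for every prime p (i.e., for every prime p there exists a symmetric V ∈ M_n(ℚ_p) with det V ≠ 0 and matrices S₁, S₂ ∈ M_{n×m}(ℚ_p) with S_iᵀ V S_i = ℓ_i) if and only if the pair is buried in a genus of rank n, i.e., there exist positive definite integral quadratic forms L and L′ of rank n lying in the same genus such that ℓ₁ is represented by L and ℓ₂ is represented by L′. -/

import Mathlib

open Matrix

/-- A positive definite integral quadratic form of rank `m`. -/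
def IsPDForm {m : ℕ} (M : Matrix (Fin m) (Fin m) ℤ) : Prop :=
  M.IsSymm ∧ ∀ x : Fin m → ℤ, x ≠ 0 → 0 < x ⬝ᵥ M.mulVec x

/-- `N` is represented by `L` if `Tᵀ L T = N` for some integer matrix `T`. -/
def Represents {n m : ℕ} (L : Matrix (Fin n) (Fin n) ℤ)
    (N : Matrix (Fin m) (Fin m) ℤ) : Prop :=
  ∃ T : Matrix (Fin n) (Fin m) ℤ, Tᵀ * L * T = N

/-- An integer `a` is represented by the form `M`. -/
def RepresentsInt {m : ℕ} (M : Matrix (Fin m) (Fin m) ℤ) (a : ℤ) : Prop :=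
  ∃ x : Fin m → ℤ, x ⬝ᵥ M.mulVec x = a

/-- Two integral forms of rank `n` are isometric. -/
def IsomForm {n : ℕ} (A B : Matrix (Fin n) (Fin n) ℤ) : Prop :=
  ∃ U : Matrix (Fin n) (Fin n) ℤ, IsUnit U.det ∧ Uᵀ * A * U = B


/-- An integral form is even if it takes only even values. -/
def IsEvenForm {m : ℕ} (M : Matrix (Fin m) (Fin m) ℤ) : Prop :=
  ∀ x : Fin m → ℤ, 2 ∣ x ⬝ᵥ M.mulVec x

/-- The pair (ℓ₁, ℓ₂) of integral forms of rank m is buried in rank n over the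
commutative ring R: some nondegenerate symmetric n×n matrix over R represents
both ℓ₁ and ℓ₂ over R. -/
def BuriedIn (R : Type*) [CommRing R] {m : ℕ} (n : ℕ)
    (ℓ₁ ℓ₂ : Matrix (Fin m) (Fin m) ℤ) : Prop :=
  ∃ L : Matrix (Fin n) (Fin n) R, L.IsSymm ∧ L.det ≠ 0 ∧
    (∃ T : Matrix (Fin n) (Fin m) R, Tᵀ * L * T = ℓ₁.map (Int.cast : ℤ → R)) ∧
    (∃ T : Matrix (Fin n) (Fin m) R, Tᵀ * L * T = ℓ₂.map (Int.cast : ℤ → R))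

/-- Two integral forms of rank n lie in the same genus: they are equivalent over ℤ_p
for every prime p (and both are positive definite, which is assumed separately). -/
def SameGenus {n : ℕ} (L L' : Matrix (Fin n) (Fin n) ℤ) : Prop :=
  ∀ (p : ℕ) [Fact p.Prime], ∃ U : Matrix (Fin n) (Fin n) ℤ_[p],
    IsUnit U.det ∧ Uᵀ * L.map (Int.cast : ℤ → ℤ_[p]) * U = L'.map (Int.cast : ℤ → ℤ_[p])

namespace Bur

/-- Isotropy of the ternary form `⟨a,b,c⟩` over `K`. -/
def Iso3 (K : Type*) [Field K] (a b c : ℤ) : Prop :=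
  ∃ x y z : K, (x ≠ 0 ∨ y ≠ 0 ∨ z ≠ 0) ∧ (a : K) * x ^ 2 + b * y ^ 2 + c * z ^ 2 = 0

section field
variable {K : Type*} [Field K] [CharZero K]

theorem Iso3.rot {a b c : ℤ} (h : Iso3 K a b c) : Iso3 K b c a := by
  obtain ⟨x, y, z, hn, h⟩ := h
  exact ⟨y, z, x, by tauto, by linear_combination h⟩

theorem Iso3.swap {a b c : ℤ} (h : Iso3 K a b c) : Iso3 K b a c := by
  obtain ⟨x, y, z, hn, h⟩ := h
  exact ⟨y, x, z, by tauto, by linear_combination h⟩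

theorem iso3_scale {a b c : ℤ} (k : ℤ) (hk : k ≠ 0) :
    Iso3 K (k * a) (k * b) (k * c) ↔ Iso3 K a b c := by
  have hk' : (k : K) ≠ 0 := by exact_mod_cast hk
  constructor
  · rintro ⟨x, y, z, hn, h⟩
    refine ⟨x, y, z, hn, ?_⟩
    apply mul_left_cancel₀ hk'
    push_cast at h
    linear_combination h
  · rintro ⟨x, y, z, hn, h⟩
    refine ⟨x, y, z, hn, ?_⟩
    push_cast
    linear_combination (k : K) * h

theorem iso3_sq {a b c : ℤ} (k : ℤ) (hk : k ≠ 0) :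
    Iso3 K (k ^ 2 * a) b c ↔ Iso3 K a b c := by
  have hk' : (k : K) ≠ 0 := by exact_mod_cast hk
  constructor
  · rintro ⟨x, y, z, hn, h⟩
    refine ⟨k * x, y, z, ?_, ?_⟩
    · simpa [hk'] using hn
    push_cast at h
    linear_combination h
  · rintro ⟨x, y, z, hn, h⟩
    refine ⟨x / k, y, z, ?_, ?_⟩
    · simpa [hk'] using hn
    push_cast
    field_simp
    linear_combination h

theorem iso3_move {a b c : ℤ} (k : ℤ) (hk : k ≠ 0) :
    Iso3 K (k * a) (k * b) c ↔ Iso3 K a b (k * c) := by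
  rw [← iso3_scale (K := K) k hk (a := a)]
  constructor
  · intro h
    have := ((iso3_sq (K := K) k hk).2 h.rot.rot).rot
    convert this using 1; ring
  · intro h
    have h1 := h.rot.rot
    rw [← mul_assoc, ← sq, iso3_sq k hk] at h1
    exact h1.rot

theorem iso3_norm {a b b' t : ℤ} (hb : b ≠ 0) (ht : t ^ 2 = a + b * b')
    (h : Iso3 K 1 (-a) (-b)) : Iso3 K 1 (-a) (-b') := by
  obtain ⟨x, y, z, hn, h⟩ := h
  have hb1 : (b : K) ≠ 0 := by exact_mod_cast hb
  have ht1 : (t : K) ^ 2 = a + b * b' := by exact_mod_cast ht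
  push_cast at h
  by_cases hz : z = 0
  · refine ⟨x, y, z, hn, ?_⟩
    subst hz
    push_cast
    linear_combination h
  · refine ⟨x * t + a * y, x + y * t, b * z, ?_, ?_⟩
    · right; right; exact mul_ne_zero hb1 hz
    · push_cast
      linear_combination (t ^ 2 - (a : K)) * h + (b * z ^ 2) * ht1

end field

section padic
variable {p : ℕ} [hp : Fact p.Prime]

theorem padic_isSquare_of_near {w : ℤ_[p]} (h : ‖w - 1‖ < ‖(2 : ℤ_[p])‖ ^ 2) : IsSquare w := by
  have := hensels_lemma (p := p) (F := (Polynomial.X ^ 2 - Polynomial.C w : Polynomial ℤ_[p]))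
    (a := 1) (by
      simpa [Polynomial.derivative_X_pow, norm_sub_rev, one_add_one_eq_two] using h)
  obtain ⟨z, hz, -⟩ := this
  simp at hz
  exact ⟨z, by linear_combination -hz⟩

theorem int_isSquare_padic (hp2 : p ≠ 2) {u : ℤ} (hu : ¬ (p : ℤ) ∣ u) (hs : IsSquare (u : ZMod p)) :
    IsSquare (u : ℚ_[p]) := by
  obtain ⟨s, hs⟩ := hs
  obtain ⟨s, rfl⟩ := ZMod.intCast_surjective s
  have h1 : (p : ℤ) ∣ u - s * s := by
    rw [← ZMod.intCast_zmod_eq_zero_iff_dvd]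
    push_cast
    rw [hs]; ring
  have hsp : ¬ (p : ℤ) ∣ s := by
    intro hd
    exact hu (by simpa using dvd_add h1 (hd.mul_right s))
  have hsu : IsUnit (s : ℤ_[p]) := by
    rw [PadicInt.isUnit_iff]
    have h2 := PadicInt.norm_le_one (s : ℤ_[p])
    rcases h2.lt_or_eq with h | h
    · exact absurd ((PadicInt.norm_int_lt_one_iff_dvd s).1 h) hsp
    · exact h
  obtain ⟨r, hr⟩ := hsu.exists_right_inv
  have hw : IsSquare ((u : ℤ_[p]) * r ^ 2) := by
    apply padic_isSquare_of_near
    have h2 : ‖(2 : ℤ_[p])‖ = 1 := by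
      have h2 := PadicInt.norm_le_one ((2 : ℤ) : ℤ_[p])
      rcases h2.lt_or_eq with h | h
      · have := (PadicInt.norm_int_lt_one_iff_dvd 2).1 h
        have := (Nat.prime_dvd_prime_iff_eq hp.out Nat.prime_two).1 (by exact_mod_cast this)
        exact absurd this hp2
      · exact_mod_cast h
    rw [h2]
    have : (u : ℤ_[p]) * r ^ 2 - 1 = ((u - s * s : ℤ) : ℤ_[p]) * r ^ 2 := by
      push_cast
      linear_combination ((s * r : ℤ_[p]) + 1) * hr
    rw [this, norm_mul]
    have h3 := (PadicInt.norm_int_lt_one_iff_dvd (p := p) (u - s * s)).2 h1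
    have h4 := PadicInt.norm_le_one (r ^ 2)
    have h5 := norm_nonneg ((u - s * s : ℤ) : ℤ_[p])
    nlinarith
  obtain ⟨w, hw⟩ := hw
  refine ⟨w * s, ?_⟩
  have : (u : ℤ_[p]) = (w * s) * (w * s) := by
    linear_combination (s : ℤ_[p]) ^ 2 * hw + (-(u : ℤ_[p]) * (s * r + 1)) * hr
  exact_mod_cast congrArg (fun x : ℤ_[p] => (x : ℚ_[p])) this

theorem iso3_of_isSquare {K : Type*} [Field K] [CharZero K] {a b c : ℤ} (hb : b ≠ 0)
    (h : IsSquare ((-(b * c) : ℤ) : K)) : Iso3 K a b c := by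
  obtain ⟨s, hs⟩ := h
  have hb1 : (b : K) ≠ 0 := by exact_mod_cast hb
  refine ⟨0, s / b, 1, by simp, ?_⟩
  push_cast at hs
  field_simp
  linear_combination -hs

theorem iso3_good (hp2 : p ≠ 2) {a b c : ℤ} (ha : ¬ (p : ℤ) ∣ a) (hb : ¬ (p : ℤ) ∣ b)
    (hc : ¬ (p : ℤ) ∣ c) : Iso3 ℚ_[p] a b c := by
  have main : ∀ a b x y : ℤ, ¬ (p : ℤ) ∣ a → ¬ (p : ℤ) ∣ x → (p : ℤ) ∣ a * x ^ 2 + b * y ^ 2 + c →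
      Iso3 ℚ_[p] a b c := by
    intro a b x y ha hx h
    have hpp : Prime (p : ℤ) := Nat.prime_iff_prime_int.1 hp.out
    have h1 : IsSquare ((-(a * (b * y ^ 2 + c)) : ℤ) : ℚ_[p]) := by
      apply int_isSquare_padic hp2
      · intro hd
        have : (p : ℤ) ∣ (a * x) ^ 2 := by
          have h5 := dvd_add (h.mul_left a) hd
          have e5 : a * (a * x ^ 2 + b * y ^ 2 + c) + -(a * (b * y ^ 2 + c)) = (a * x) ^ 2 := by ring
          rwa [e5] at h5
        rcases hpp.dvd_or_dvd (hpp.dvd_of_dvd_pow this) with h | h <;> contradiction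
      · refine ⟨(a * x : ℤ), ?_⟩
        rw [← sub_eq_zero, ← Int.cast_mul, ← Int.cast_sub, ZMod.intCast_zmod_eq_zero_iff_dvd]
        have h5 := (h.mul_left (-a))
        have e5 : -a * (a * x ^ 2 + b * y ^ 2 + c) = -(a * (b * y ^ 2 + c)) - a * x * (a * x) := by ring
        rwa [e5] at h5
    obtain ⟨s, hs⟩ := h1
    have ha1 : (a : ℚ_[p]) ≠ 0 := by
      intro h0
      have : a = 0 := by exact_mod_cast h0
      simp [this] at ha
    refine ⟨s / a, y, 1, by simp, ?_⟩
    push_cast at hs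
    field_simp
    linear_combination -hs
  have hz : ∀ t : ℤ, ¬ (p : ℤ) ∣ t → (t : ZMod p) ≠ 0 := fun t ht h =>
    ht ((ZMod.intCast_zmod_eq_zero_iff_dvd _ _).1 h)
  obtain ⟨x, y, hxy⟩ := FiniteField.exists_root_sum_quadratic (R := ZMod p)
    (f := Polynomial.C (a : ZMod p) * Polynomial.X ^ 2 + Polynomial.C 0 * Polynomial.X + Polynomial.C (c : ZMod p))
    (g := Polynomial.C (b : ZMod p) * Polynomial.X ^ 2 + Polynomial.C 0 * Polynomial.X + Polynomial.C 0)
    (Polynomial.degree_quadratic (hz a ha)) (Polynomial.degree_quadratic (hz b hb))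
    (by rw [ZMod.card]; exact (hp.out.eq_two_or_odd).resolve_left hp2)
  obtain ⟨x, rfl⟩ := ZMod.intCast_surjective x
  obtain ⟨y, rfl⟩ := ZMod.intCast_surjective y
  have hd : (p : ℤ) ∣ a * x ^ 2 + b * y ^ 2 + c := by
    rw [← ZMod.intCast_zmod_eq_zero_iff_dvd]
    simp at hxy
    push_cast
    linear_combination hxy
  by_cases hx : (p : ℤ) ∣ x
  · by_cases hy : (p : ℤ) ∣ y
    · exfalso; apply hc
      have h1 : (p : ℤ) ∣ a * x ^ 2 + b * y ^ 2 :=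
        dvd_add ((dvd_pow hx two_ne_zero).mul_left a) ((dvd_pow hy two_ne_zero).mul_left b)
      exact (dvd_add_right h1).1 hd
    · exact (main b a y x hb hy (by convert hd using 1; ring)).swap
  · exact main a b x y ha hx hd

theorem iso3_prim {a b c : ℤ} (h : Iso3 ℚ_[p] a b c) (k : ℕ) :
    ∃ x y z : ℤ, ¬ ((p : ℤ) ∣ x ∧ (p : ℤ) ∣ y ∧ (p : ℤ) ∣ z) ∧
      (p : ℤ) ^ k ∣ a * x ^ 2 + b * y ^ 2 + c * z ^ 2 := by
  have main : ∀ a b c : ℤ, ∀ x y z : ℚ_[p], z ≠ 0 → ‖x‖ ≤ ‖z‖ → ‖y‖ ≤ ‖z‖ →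
      (a : ℚ_[p]) * x ^ 2 + b * y ^ 2 + c * z ^ 2 = 0 →
      ∃ X Y : ℤ, (p : ℤ) ^ k ∣ a * X ^ 2 + b * Y ^ 2 + c * 1 ^ 2 := by
    intro a b c x y z hz hx hy h
    have hz' : 0 < ‖z‖ := norm_pos_iff.2 hz
    let X : ℤ_[p] := ⟨x / z, by rw [norm_div]; exact div_le_one_of_le₀ hx hz'.le⟩
    let Y : ℤ_[p] := ⟨y / z, by rw [norm_div]; exact div_le_one_of_le₀ hy hz'.le⟩
    have hXY : (a : ℤ_[p]) * X ^ 2 + b * Y ^ 2 + c = 0 := by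
      apply PadicInt.ext
      push_cast
      simp only [X, Y]
      field_simp
      linear_combination h
    obtain ⟨X', hX⟩ := ZMod.intCast_surjective (PadicInt.toZModPow k X)
    obtain ⟨Y', hY⟩ := ZMod.intCast_surjective (PadicInt.toZModPow k Y)
    refine ⟨X', Y', ?_⟩
    have h2 := congrArg (PadicInt.toZModPow k) hXY
    simp only [map_add, map_mul, map_pow, map_intCast, map_zero, ← hX, ← hY] at h2
    have h3 := (ZMod.intCast_zmod_eq_zero_iff_dvd (a * X' ^ 2 + b * Y' ^ 2 + c * 1 ^ 2) (p ^ k)).1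
      (by push_cast; linear_combination h2)
    exact_mod_cast h3
  have h1p : ¬ (p : ℤ) ∣ 1 := by
    intro h
    exact hp.out.one_lt.ne' (by exact_mod_cast Int.eq_one_of_dvd_one (by positivity) h)
  obtain ⟨x, y, z, hn, h⟩ := h
  by_cases c1 : ‖x‖ ≤ ‖z‖ ∧ ‖y‖ ≤ ‖z‖
  · have hz : z ≠ 0 := by
      rintro rfl
      simp at c1
      simp [c1] at hn
    obtain ⟨X, Y, hXY⟩ := main a b c x y z hz c1.1 c1.2 h
    exact ⟨X, Y, 1, fun h => h1p h.2.2, hXY⟩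
  by_cases c2 : ‖x‖ ≤ ‖y‖ ∧ ‖z‖ ≤ ‖y‖
  · have hz : y ≠ 0 := by
      rintro rfl
      simp at c2
      simp [c2] at hn
    obtain ⟨X, Y, hXY⟩ := main a c b x z y hz c2.1 c2.2 (by linear_combination h)
    exact ⟨X, 1, Y, fun h => h1p h.2.1, by convert hXY using 1; ring⟩
  · have c3 : ‖y‖ ≤ ‖x‖ ∧ ‖z‖ ≤ ‖x‖ := by grind
    have hz : x ≠ 0 := by
      rintro rfl
      simp at c3
      simp [c3] at hn
    obtain ⟨X, Y, hXY⟩ := main b c a y z x hz c3.1 c3.2 (by linear_combination h)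
    exact ⟨1, X, Y, fun h => h1p h.1, by convert hXY using 1; ring⟩

/-- Necessary condition at a prime dividing exactly one coefficient, exactly once. -/
theorem isSquare_of_iso3 {a b c : ℤ} (h : Iso3 ℚ_[p] a b c) (ha : (p : ℤ) ∣ a)
    (ha2 : ¬ (p : ℤ) ^ 2 ∣ a) (hb : ¬ (p : ℤ) ∣ b) :
    IsSquare ((-(b * c) : ℤ) : ZMod p) := by
  have hpp : Prime (p : ℤ) := Nat.prime_iff_prime_int.1 hp.out
  obtain ⟨x, y, z, hn, h⟩ := iso3_prim h 2
  have h1 : (p : ℤ) ∣ b * y ^ 2 + c * z ^ 2 := by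
    have h2 := (dvd_pow_self (p : ℤ) two_ne_zero).trans h
    rw [add_assoc] at h2
    exact (dvd_add_right (ha.mul_right _)).1 h2
  by_cases hz : (p : ℤ) ∣ z
  · exfalso
    have hy : (p : ℤ) ∣ y := by
      have := (dvd_add_left ((dvd_pow hz two_ne_zero).mul_left c)).1 h1
      exact hpp.dvd_of_dvd_pow ((hpp.dvd_or_dvd this).resolve_left hb)
    have h3 : (p : ℤ) ^ 2 ∣ a * x ^ 2 := by
      have e1 := (pow_dvd_pow_of_dvd hy 2).mul_left b
      have e2 := (pow_dvd_pow_of_dvd hz 2).mul_left c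
      exact (dvd_add_left e1).1 ((dvd_add_left e2).1 h)
    have hx : ¬ (p : ℤ) ∣ x := fun hx => hn ⟨hx, hy, hz⟩
    have hco : IsCoprime ((p : ℤ) ^ 2) (x ^ 2) := by
      apply IsCoprime.pow
      exact (hpp.coprime_iff_not_dvd).2 hx
    exact ha2 (hco.dvd_of_dvd_mul_right h3)
  · have hz' : (z : ZMod p) ≠ 0 := fun h => hz ((ZMod.intCast_zmod_eq_zero_iff_dvd _ _).1 h)
    have h4 := (ZMod.intCast_zmod_eq_zero_iff_dvd _ p).2 h1
    push_cast at h4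
    refine ⟨b * y / z, ?_⟩
    push_cast
    field_simp
    linear_combination (-b : ZMod p) * h4

end padic
end Bur

namespace Bur

theorem isSquare_zmod_of_squarefree (a : ℤ) : ∀ n : ℕ, Squarefree n →
    (∀ p : ℕ, p.Prime → p ∣ n → IsSquare (a : ZMod p)) → IsSquare (a : ZMod n) := by
  intro n
  induction n using induction_on_primes with
  | zero => intro h; simp at h
  | one => intro _ _; exact ⟨0, Subsingleton.elim _ _⟩
  | prime_mul p n hp ih =>
    intro hs hq
    have hc : p.Coprime n := Nat.coprime_of_squarefree_mul hs
    obtain ⟨x, hx⟩ := hq p hp (dvd_mul_right _ _)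
    obtain ⟨y, hy⟩ := ih hs.of_mul_right (fun r hr hd => hq r hr (hd.mul_left p))
    have h : IsSquare ((a : ZMod p × ZMod n)) := by
      refine ⟨(x, y), ?_⟩
      ext
      · simpa using hx
      · simpa using hy
    simpa using h.map (ZMod.chineseRemainder hc).symm

theorem legendre_aux (N : ℕ) : ∀ a b : ℤ, a ≠ 0 → b ≠ 0 → (0 < a ∨ 0 < b) →
    a.natAbs + b.natAbs ≤ N →
    (∀ (p : ℕ) [Fact p.Prime], p ≠ 2 → Iso3 ℚ_[p] 1 (-a) (-b)) → Iso3 ℚ 1 (-a) (-b) := by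
  induction N using Nat.strong_induction_on with
  | _ N ih =>
  have main : ∀ a b : ℤ, a ≠ 0 → b ≠ 0 → (0 < a ∨ 0 < b) →
    a.natAbs + b.natAbs ≤ N → a.natAbs ≤ b.natAbs →
    (∀ (p : ℕ) [Fact p.Prime], p ≠ 2 → Iso3 ℚ_[p] 1 (-a) (-b)) → Iso3 ℚ 1 (-a) (-b) := by
    intro a b ha hb hpos hN hab hloc
    by_cases hsq : Squarefree b
    · by_cases hb1 : b.natAbs = 1
      · have ha1 : a.natAbs = 1 := by omega
        rcases hpos with h | h
        · have : a = 1 := by omega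
          subst this
          exact ⟨1, 1, 0, by simp, by simp⟩
        · have : b = 1 := by omega
          subst this
          exact ⟨1, 0, 1, by simp, by simp⟩
      · have hb2 : 2 ≤ b.natAbs := by omega
        have : NeZero b.natAbs := ⟨by omega⟩
        have hs : IsSquare (a : ZMod b.natAbs) := by
          apply isSquare_zmod_of_squarefree
          · exact Int.squarefree_natAbs.2 hsq
          · intro p hp hd
            have : Fact p.Prime := ⟨hp⟩
            by_cases hp2 : p = 2
            · subst hp2
              generalize (a : ZMod 2) = t
              revert t; decide
            · have h1 := (hloc p hp2).rot.rot
              have hd' : (p : ℤ) ∣ b := Int.natCast_dvd.2 hd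
              have := isSquare_of_iso3 h1 (dvd_neg.2 hd') (by
                intro h2
                have h3 := hsq p (by rw [dvd_neg] at h2; rwa [← sq])
                have := Int.isUnit_iff.1 h3
                have := hp.two_le
                omega) (by
                intro h2
                have := Int.eq_one_of_dvd_one (by positivity) h2
                have := hp.two_le
                omega)
              simpa using this
        obtain ⟨t, ht⟩ := hs
        obtain ⟨T, hT, hTle⟩ : ∃ T : ℤ, (T : ZMod b.natAbs) = t ∧ T.natAbs ≤ b.natAbs / 2 :=
          ⟨t.valMinAbs, t.coe_valMinAbs, t.natAbs_valMinAbs_le⟩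
        have hdvd : b ∣ T ^ 2 - a := by
          rw [← Int.natAbs_dvd, ← ZMod.intCast_zmod_eq_zero_iff_dvd]
          push_cast
          rw [ht, hT]; ring
        obtain ⟨b', hb'⟩ := hdvd
        have hT2 : T ^ 2 = a + b * b' := by linarith
        by_cases hb0 : b' = 0
        · refine ⟨T, 1, 0, by simp, ?_⟩
          have : (T : ℚ) ^ 2 = a + b * b' := by exact_mod_cast hT2
          rw [this, hb0]; push_cast; ring
        have hlt : b'.natAbs < b.natAbs := by
          zify at hTle hab hb2 ⊢
          by_contra hcon
          push Not at hcon
          have h1 : |b| * |b'| ≤ |T| ^ 2 + |a| := by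
            rw [← abs_mul, ← hb', sq_abs]
            calc |T ^ 2 - a| ≤ |T ^ 2| + |a| := abs_sub _ _
              _ = _ := by rw [abs_of_nonneg (sq_nonneg T)]
          have h2 : 2 * |T| ≤ |b| := by omega
          have h3 : 0 ≤ |T| := abs_nonneg _
          nlinarith
        have hres := ih (a.natAbs + b'.natAbs) (by omega) a b' ha hb0 (by
          by_contra hcon
          push Not at hcon
          have hbp : 0 < b := by rcases hpos with h | h <;> omega
          have : b' < 0 := by omega
          have : a < 0 := by omega
          nlinarith [mul_neg_of_pos_of_neg hbp (by omega : b' < 0), sq_nonneg T]) le_rfl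
          (fun p _ hp2 => iso3_norm hb hT2 (hloc p hp2))
        exact iso3_norm hb0 (by rw [hT2]; ring) hres
    · rw [Squarefree] at hsq
      push Not at hsq
      obtain ⟨d, ⟨b1, hd⟩, hu⟩ := hsq
      have hd0 : d ≠ 0 := by rintro rfl; simp at hd; exact hb hd
      have hb10 : b1 ≠ 0 := by rintro rfl; simp at hd; exact hb hd
      have hd2 : 2 ≤ d.natAbs := by
        have := mt Int.isUnit_iff.2 hu
        omega
      have hlt : b1.natAbs < b.natAbs := by
        rw [hd, Int.natAbs_mul, Int.natAbs_mul]
        have h1 : 0 < b1.natAbs := by omega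
        have h2 : 2 * 2 ≤ d.natAbs * d.natAbs := Nat.mul_le_mul hd2 hd2
        nlinarith
      have key : ∀ (K : Type) [Field K] [CharZero K], Iso3 K 1 (-a) (-b) ↔ Iso3 K 1 (-a) (-b1) := by
        intro K _ _
        have e : -b = d ^ 2 * (-b1) := by rw [hd]; ring
        rw [e]
        constructor
        · intro h
          exact ((iso3_sq d hd0).1 h.rot.rot).rot
        · intro h
          exact ((iso3_sq d hd0).2 h.rot.rot).rot
      rw [key]
      refine ih (a.natAbs + b1.natAbs) (by omega) a b1 ha hb10 ?_ le_rfl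
        (fun p _ hp2 => (key _).1 (hloc p hp2))
      refine hpos.imp_right ?_
      intro h
      rw [hd] at h
      have : 0 < d * d := mul_self_pos.2 hd0
      exact pos_of_mul_pos_right h this.le
  intro a b ha hb hpos hN hloc
  rcases le_total a.natAbs b.natAbs with h | h
  · exact main a b ha hb hpos hN h hloc
  · have := main b a hb ha hpos.symm (by omega) h (fun p _ hp2 => (hloc p hp2).rot.swap.rot.rot)
    exact this.rot.swap.rot.rot

/-- Legendre's theorem, for `a x² + b y² = c z²`. -/
theorem legendre {a b c : ℕ} (ha : 0 < a) (hb : 0 < b) (hc : 0 < c)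
    (h : ∀ (p : ℕ) [Fact p.Prime], p ≠ 2 → Iso3 ℚ_[p] a b (-c)) : Iso3 ℚ a b (-c) := by
  have key : ∀ (K : Type) [Field K] [CharZero K], Iso3 K a b (-c) ↔
      Iso3 K 1 (-(a * c : ℤ)) (-(b * c : ℤ)) := by
    intro K _ _
    have hc' : (c : ℤ) ≠ 0 := by positivity
    have e1 : (1 : ℤ) = 1 := rfl
    rw [← iso3_scale (K := K) (-c : ℤ) (by simpa using hc')]
    constructor
    · intro h
      have := h.rot.rot
      rw [show (-c : ℤ) * -c = c ^ 2 * 1 by ring, iso3_sq _ hc'] at this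
      convert this using 1 <;> ring
    · intro h
      have := (iso3_sq _ hc').2 h
      convert this.rot using 1 <;> ring
  rw [key]
  exact legendre_aux _ _ _ (by positivity) (by positivity) (Or.inl (by positivity)) le_rfl
    (fun p _ hp2 => (key _).1 (h p hp2))

end Bur

namespace Bur
open scoped NumberTheorySymbols

theorem recip {a b : ℕ} (ha : Odd a) (hb : Odd b) (hab : a.Coprime b) :
    J(a | b) * J(b | a) = if a % 4 = 3 ∧ b % 4 = 3 then -1 else 1 := by
  rw [← jacobiSym.quadratic_reciprocity_if (Nat.odd_iff.1 ha) (Nat.odd_iff.1 hb)]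
  have h1 : J(b | a) ^ 2 = 1 := jacobiSym.sq_one (by simpa using hab.symm)
  split_ifs <;> nlinarith

theorem recip3 {a b c : ℕ} (ha : Odd a) (hb : Odd b) (hc : Odd c) (hab : a.Coprime b)
    (hac : a.Coprime c) (hbc : b.Coprime c) :
    J(b * c | a) * J(a * c | b) * J(-(a * b) | c) =
      (if a % 4 = 3 ∧ b % 4 = 3 then -1 else 1) * (if a % 4 = 3 ∧ c % 4 = 3 then -1 else 1) *
      (if b % 4 = 3 ∧ c % 4 = 3 then -1 else 1) * (if c % 4 = 1 then 1 else -1) := by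
  rw [← recip ha hb hab, ← recip ha hc hac, ← recip hb hc hbc]
  rw [show (-(a * b : ℤ)) = -1 * (a * b) by ring]
  simp only [jacobiSym.mul_left, jacobiSym.at_neg_one hc, ZMod.χ₄_nat_eq_if_mod_four]
  have : c % 2 ≠ 0 := by have := Nat.odd_iff.1 hc; omega
  simp only [this, if_false]
  ring

theorem jac_two {b : ℕ} (hb : Odd b) : J(2 | b) = if b % 8 = 1 ∨ b % 8 = 7 then 1 else -1 := by
  rw [jacobiSym.at_two hb, ZMod.χ₈_nat_eq_if_mod_eight]
  have : b % 2 ≠ 0 := by have := Nat.odd_iff.1 hb; omega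
  simp only [this, if_false]

theorem odd_sq_form (a x : ℤ) (hx : x % 2 = 1) : ∃ k, a * x ^ 2 = 8 * k + a := by
  obtain ⟨k, hk⟩ := Int.eight_dvd_sq_sub_one_of_odd (Int.odd_iff.2 hx)
  exact ⟨a * k, by linear_combination a * hk⟩

theorem even_sq_form (a x : ℤ) (hx : x % 2 = 0) : ∃ k, a * x ^ 2 = 4 * k := by
  obtain ⟨k, rfl⟩ := Int.even_iff.2 hx
  exact ⟨a * k ^ 2, by ring⟩

theorem sq_form (a x : ℤ) : (x % 2 = 1 ∧ ∃ k, a * x ^ 2 = 8 * k + a) ∨ (x % 2 = 0 ∧ ∃ k, a * x ^ 2 = 4 * k) := by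
  rcases Int.emod_two_eq_zero_or_one x with h | h
  · exact Or.inr ⟨h, even_sq_form a x h⟩
  · exact Or.inl ⟨h, odd_sq_form a x h⟩

theorem prod_odd {a b c : ℕ} (ha : Odd a) (hb : Odd b) (hc : Odd c) (hab : a.Coprime b)
    (hac : a.Coprime c) (hbc : b.Coprime c) (h : Iso3 ℚ_[2] a b (-c)) :
    J(b * c | a) * J(a * c | b) * J(-(a * b) | c) = 1 := by
  obtain ⟨x, y, z, hn, hd⟩ := iso3_prim h 3
  rw [Nat.odd_iff] at ha hb hc
  have h1 : (a + b) % 4 = 0 ∨ a % 4 = c % 4 ∨ b % 4 = c % 4 := by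
    rcases sq_form a x with ⟨hx, k1, h1⟩ | ⟨hx, k1, h1⟩ <;>
    rcases sq_form b y with ⟨hy, k2, h2⟩ | ⟨hy, k2, h2⟩ <;>
    rcases sq_form (-c) z with ⟨hz, k3, h3⟩ | ⟨hz, k3, h3⟩ <;>
    rw [h1, h2, h3] at hd <;> omega
  rw [recip3 (Nat.odd_iff.2 ha) (Nat.odd_iff.2 hb) (Nat.odd_iff.2 hc) hab hac hbc]
  split_ifs <;> first | rfl | omega

theorem prod_a {a b c : ℕ} (ha : Odd a) (hb : Odd b) (hc : Odd c) (hab : a.Coprime b)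
    (hac : a.Coprime c) (hbc : b.Coprime c) (h : Iso3 ℚ_[2] (2 * a : ℕ) b (-c)) :
    J(b * c | a) * J((2 * a : ℕ) * c | b) * J(-((2 * a : ℕ) * b) | c) = 1 := by
  obtain ⟨x, y, z, hn, hd⟩ := iso3_prim h 3
  have e1 : J((2 * a : ℕ) * c | b) = J(2 | b) * J(a * c | b) := by
    rw [← jacobiSym.mul_left]; push_cast; ring_nf
  have e2 : J(-((2 * a : ℕ) * b) | c) = J(2 | c) * J(-(a * b) | c) := by
    rw [← jacobiSym.mul_left]; push_cast; ring_nf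
  have e3 := recip3 ha hb hc hab hac hbc
  rw [e1, e2, jac_two hb, jac_two hc]
  rw [Nat.odd_iff] at ha hb hc
  have h1 : b % 8 = c % 8 ∨ c % 8 = (b + 2 * a) % 8 := by
    push_cast at hd
    rw [show (2 * a : ℤ) * x ^ 2 = 2 * (a * x ^ 2) by ring] at hd
    rcases sq_form a x with ⟨hx, k1, h1⟩ | ⟨hx, k1, h1⟩ <;>
    rcases sq_form b y with ⟨hy, k2, h2⟩ | ⟨hy, k2, h2⟩ <;>
    rcases sq_form (-c) z with ⟨hz, k3, h3⟩ | ⟨hz, k3, h3⟩ <;>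
    rw [h1, h2, h3] at hd <;> omega
  rw [show ∀ p q r s t : ℤ, p * (q * r) * (s * t) = (p * r * t) * (q * s) by intros; ring, e3]
  split_ifs <;> first | rfl | omega

theorem prod_c {a b c : ℕ} (ha : Odd a) (hb : Odd b) (hc : Odd c) (hab : a.Coprime b)
    (hac : a.Coprime c) (hbc : b.Coprime c) (h : Iso3 ℚ_[2] a b (-(2 * c : ℕ))) :
    J(b * (2 * c : ℕ) | a) * J(a * (2 * c : ℕ) | b) * J(-(a * b) | c) = 1 := by
  obtain ⟨x, y, z, hn, hd⟩ := iso3_prim h 3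
  have e1 : J(b * (2 * c : ℕ) | a) = J(2 | a) * J(b * c | a) := by
    rw [← jacobiSym.mul_left]; push_cast; ring_nf
  have e2 : J(a * (2 * c : ℕ) | b) = J(2 | b) * J(a * c | b) := by
    rw [← jacobiSym.mul_left]; push_cast; ring_nf
  have e3 := recip3 ha hb hc hab hac hbc
  rw [e1, e2, jac_two hb, jac_two ha]
  rw [Nat.odd_iff] at ha hb hc
  have h1 : (a + b) % 8 = 0 ∨ (a + b) % 8 = (2 * c) % 8 := by
    push_cast at hd
    rw [show -(2 * c : ℤ) * z ^ 2 = -(2 * (c * z ^ 2)) by ring] at hd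
    rcases sq_form a x with ⟨hx, k1, h1⟩ | ⟨hx, k1, h1⟩ <;>
    rcases sq_form b y with ⟨hy, k2, h2⟩ | ⟨hy, k2, h2⟩ <;>
    rcases sq_form c z with ⟨hz, k3, h3⟩ | ⟨hz, k3, h3⟩ <;>
    rw [h1, h2, h3] at hd <;> omega
  rw [show ∀ p q r s t : ℤ, (p * q) * (r * s) * t = (q * s * t) * (p * r) by intros; ring, e3]
  split_ifs <;> first | rfl | omega

/-- Product formula, using odd parts. -/
theorem prod_formula {a b c : ℕ} (ha : Squarefree a) (hb : Squarefree b) (hc : Squarefree c)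
    (hab : a.Coprime b) (hac : a.Coprime c) (hbc : b.Coprime c) (h : Iso3 ℚ_[2] a b (-c)) :
    ∃ A B C : ℕ, Odd A ∧ Odd B ∧ Odd C ∧ (a = A ∨ a = 2 * A) ∧ (b = B ∨ b = 2 * B) ∧
      (c = C ∨ c = 2 * C) ∧ J(b * c | A) * J(a * c | B) * J(-(a * b) | C) = 1 := by
  have half : ∀ n : ℕ, Squarefree n → ¬ Odd n → ∃ m, Odd m ∧ n = 2 * m := by
    intro n hn ho
    rw [Nat.not_odd_iff_even] at ho
    obtain ⟨m, rfl⟩ := ho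
    refine ⟨m, ?_, by ring⟩
    by_contra hm
    rw [Nat.not_odd_iff_even] at hm
    obtain ⟨k, rfl⟩ := hm
    have := hn 2 ⟨k, by ring⟩
    simp at this
  have odd_of : ∀ m n : ℕ, (2 * m).Coprime n → Odd n := fun m n h =>
    Nat.coprime_two_left.1 (Nat.Coprime.coprime_mul_right h)
  by_cases oa : Odd a
  · by_cases ob : Odd b
    · by_cases oc : Odd c
      · exact ⟨a, b, c, oa, ob, oc, by simp, by simp, by simp, prod_odd oa ob oc hab hac hbc h⟩
      · obtain ⟨C, hC, rfl⟩ := half c hc oc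
        exact ⟨a, b, C, oa, ob, hC, by simp, by simp, by simp,
          prod_c oa ob hC hab hac.coprime_mul_left_right hbc.coprime_mul_left_right h⟩
    · obtain ⟨B, hB, rfl⟩ := half b hb ob
      have oc := odd_of _ _ hbc
      refine ⟨a, B, c, oa, hB, oc, by simp, by simp, by simp, ?_⟩
      have := prod_a hB oa oc hab.symm.coprime_mul_left hbc.coprime_mul_left hac h.swap
      rw [← this, mul_comm ((2 * B : ℕ) : ℤ) (a : ℤ)]
      ring
  · obtain ⟨A, hA, rfl⟩ := half a ha oa
    have ob := odd_of _ _ hab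
    have oc := odd_of _ _ hac
    exact ⟨A, b, c, hA, ob, oc, by simp, by simp, by simp,
      prod_a hA ob oc hab.coprime_mul_left hac.coprime_mul_left hbc h⟩

theorem jac_one (x : ℤ) (q : ℕ) : ∀ n : ℕ, (∀ p : ℕ, p.Prime → p ∣ n → p ≠ q → J(x | p) = 1) →
    ¬ q ∣ n → J(x | n) = 1 := by
  intro n
  induction n using induction_on_primes with
  | zero => intro _ _; simp
  | one => intro _ _; simp
  | prime_mul p n hp ih =>
    intro h hq
    by_cases hn : n = 0
    · subst hn; simp
    rw [jacobiSym.mul_right' _ hp.ne_zero hn, h p hp (dvd_mul_right _ _) (by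
      rintro rfl; exact hq (dvd_mul_right _ _)), one_mul]
    exact ih (fun r hr hd => h r hr (hd.mul_left p)) (fun h => hq (h.mul_left p))

theorem jac_q (x : ℤ) {q : ℕ} (hq : q.Prime) (n : ℕ) (hn : Squarefree n)
    (h : ∀ p : ℕ, p.Prime → p ∣ n → p ≠ q → J(x | p) = 1) (hd : q ∣ n) : J(x | n) = J(x | q) := by
  obtain ⟨m, rfl⟩ := hd
  have hm : m ≠ 0 := by rintro rfl; simp at hn
  rw [jacobiSym.mul_right' _ hq.ne_zero hm, jac_one x q m (fun r hr hd => h r hr (hd.mul_left q)),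
    mul_one]
  intro hqm
  have := hn q (mul_dvd_mul_left q hqm)
  exact hq.not_isUnit this

/-- local symbol at a prime dividing `a` -/
theorem jac_local {p : ℕ} [hp : Fact p.Prime] {a b c : ℤ} (h : Iso3 ℚ_[p] a b c)
    (ha : Squarefree a) (hpa : (p : ℤ) ∣ a) (hb : ¬ (p : ℤ) ∣ b) (hc : ¬ (p : ℤ) ∣ c) :
    J(-(b * c) | p) = 1 := by
  have hpp : Prime (p : ℤ) := Nat.prime_iff_prime_int.1 hp.out
  have h1 := isSquare_of_iso3 h hpa (fun h2 => by
    rw [sq] at h2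
    exact hpp.not_isUnit (ha _ h2)) hb
  rw [← jacobiSym.legendreSym.to_jacobiSym, legendreSym.eq_one_iff]
  · exact h1
  · intro h0
    rw [ZMod.intCast_zmod_eq_zero_iff_dvd, dvd_neg] at h0
    rcases hpp.dvd_or_dvd h0 <;> contradiction

end Bur

namespace Bur
open scoped NumberTheorySymbols

theorem ternary_coprime {q : ℕ} (hq : q.Prime) (hq2 : q ≠ 2) {a b c : ℕ}
    (ha : Squarefree a) (hb : Squarefree b) (hc : Squarefree c)
    (hab : a.Coprime b) (hac : a.Coprime c) (hbc : b.Coprime c)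
    (h : ∀ (p : ℕ) [Fact p.Prime], p ≠ q → Iso3 ℚ_[p] a b (-c)) : Iso3 ℚ a b (-c) := by
  have a0 : a ≠ 0 := ha.ne_zero
  have b0 : b ≠ 0 := hb.ne_zero
  have c0 : c ≠ 0 := hc.ne_zero
  apply legendre (Nat.pos_of_ne_zero a0) (Nat.pos_of_ne_zero b0) (Nat.pos_of_ne_zero c0)
  intro p hp hp2
  by_cases hpq : p = q
  swap
  · exact h p hpq
  subst hpq
  obtain ⟨A, B, C, oA, oB, oC, eA, eB, eC, hprod⟩ := prod_formula ha hb hc hab hac hbc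
    (h 2 (Ne.symm hp2))
  have nd : ∀ {r x y : ℕ}, r.Prime → x.Coprime y → r ∣ x → ¬ (r : ℤ) ∣ y := by
    intro r x y hr hxy hx hy
    exact hr.not_isUnit (Nat.isUnit_iff.2 (Nat.eq_one_of_dvd_coprimes hxy hx (by exact_mod_cast hy)))
  have sfA : Squarefree A := by
    rcases eA with rfl | rfl
    · exact ha
    · exact ha.of_mul_right
  have sfB : Squarefree B := by
    rcases eB with rfl | rfl
    · exact hb
    · exact hb.of_mul_right
  have sfC : Squarefree C := by
    rcases eC with rfl | rfl
    · exact hc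
    · exact hc.of_mul_right
  have dA : A ∣ a := by rcases eA with rfl | rfl <;> simp
  have dB : B ∣ b := by rcases eB with rfl | rfl <;> simp
  have dC : C ∣ c := by rcases eC with rfl | rfl <;> simp
  have hA : ∀ r : ℕ, r.Prime → r ∣ A → r ≠ p → J(b * c | r) = 1 := by
    intro r hr hd hrp
    have : Fact r.Prime := ⟨hr⟩
    have h1 := jac_local (h r hrp) (by simpa using (Int.squarefree_natCast.2 ha))
      (by exact_mod_cast hd.trans dA) (nd hr hab (hd.trans dA))
      (by rw [dvd_neg]; exact nd hr hac (hd.trans dA))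
    simpa using h1
  have hB : ∀ r : ℕ, r.Prime → r ∣ B → r ≠ p → J(a * c | r) = 1 := by
    intro r hr hd hrp
    have : Fact r.Prime := ⟨hr⟩
    have h1 := jac_local (h r hrp).swap (by simpa using (Int.squarefree_natCast.2 hb))
      (by exact_mod_cast hd.trans dB) (nd hr hab.symm (hd.trans dB))
      (by rw [dvd_neg]; exact nd hr hbc (hd.trans dB))
    simpa using h1
  have hC : ∀ r : ℕ, r.Prime → r ∣ C → r ≠ p → J(-(a * b) | r) = 1 := by
    intro r hr hd hrp
    have : Fact r.Prime := ⟨hr⟩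
    have h1 := jac_local (h r hrp).rot.rot (by
        rw [← Int.squarefree_natAbs]; simpa using hc)
      (by rw [dvd_neg]; exact_mod_cast hd.trans dC) (nd hr hac.symm (hd.trans dC))
      (nd hr hbc.symm (hd.trans dC))
    simpa using h1
  have oddp : ∀ {x X : ℕ}, p ∣ x → (x = X ∨ x = 2 * X) → p ∣ X := by
    intro x X hd hx
    rcases hx with rfl | rfl
    · exact hd
    · rcases (Nat.Prime.dvd_mul hq).1 hd with h | h
      · exact absurd ((Nat.prime_dvd_prime_iff_eq hq Nat.prime_two).1 h) hp2
      · exact h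
  have hpp : Prime (p : ℤ) := Nat.prime_iff_prime_int.1 hq
  have fin : ∀ u : ℤ, J(u | p) = 1 → IsSquare (u : ℚ_[p]) := by
    intro u hu
    apply int_isSquare_padic hp2
    · intro hd
      rw [← jacobiSym.legendreSym.to_jacobiSym] at hu
      have := (legendreSym.eq_zero_iff p u).2 ((ZMod.intCast_zmod_eq_zero_iff_dvd _ _).2 hd)
      omega
    · exact ZMod.isSquare_of_jacobiSym_eq_one hu
  by_cases pa : p ∣ a
  · have nb := nd hq hab pa
    have nc := nd hq hac pa
    rw [jac_q _ hq A sfA hA (oddp pa eA),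
      jac_one _ p B hB (fun h => nb (by exact_mod_cast h.trans dB)),
      jac_one _ p C hC (fun h => nc (by exact_mod_cast h.trans dC)), mul_one, mul_one] at hprod
    exact iso3_of_isSquare (by exact_mod_cast b0) (by
      have := fin _ hprod
      simpa using this)
  by_cases pb : p ∣ b
  · have na := nd hq hab.symm pb
    have nc := nd hq hbc pb
    rw [jac_q _ hq B sfB hB (oddp pb eB),
      jac_one _ p A hA (fun h => na (by exact_mod_cast h.trans dA)),
      jac_one _ p C hC (fun h => nc (by exact_mod_cast h.trans dC)), mul_one, one_mul] at hprod
    refine (iso3_of_isSquare (by exact_mod_cast a0) (?_) : Iso3 ℚ_[p] b a (-c)).swap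
    have := fin _ hprod
    simpa using this
  by_cases pc : p ∣ c
  · have na := nd hq hac.symm pc
    have nb := nd hq hbc.symm pc
    rw [jac_q _ hq C sfC hC (oddp pc eC),
      jac_one _ p A hA (fun h => na (by exact_mod_cast h.trans dA)),
      jac_one _ p B hB (fun h => nb (by exact_mod_cast h.trans dB)), mul_one, one_mul] at hprod
    exact (iso3_of_isSquare (by exact_mod_cast a0) (fin _ hprod) : Iso3 ℚ_[p] (-c) a b).rot
  · exact iso3_good hp2 (by exact_mod_cast pa) (by exact_mod_cast pb)
      (by rw [dvd_neg]; exact_mod_cast pc)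

/-- Ternary Hasse principle with one prime omitted. -/
theorem ternary {q : ℕ} (hq : q.Prime) {a b c : ℕ} (ha : 0 < a) (hb : 0 < b) (hc : 0 < c)
    (h : ∀ (p : ℕ) [Fact p.Prime], p ≠ q → Iso3 ℚ_[p] a b (-c)) : Iso3 ℚ a b (-c) := by
  by_cases hq2 : q = 2
  · subst hq2
    exact legendre ha hb hc h
  obtain ⟨N, hN⟩ : ∃ N, a * b * c = N := ⟨_, rfl⟩
  induction N using Nat.strong_induction_on generalizing a b c with
  | _ N ih =>
  subst hN
  have nsq : ∀ n : ℕ, 0 < n → ¬ Squarefree n → ∃ d m : ℕ, n = d * d * m ∧ d ≠ 0 ∧ 0 < m ∧ m < n := by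
    intro n hn hs
    rw [Squarefree] at hs
    push Not at hs
    obtain ⟨d, ⟨m, hm⟩, hu⟩ := hs
    have hd0 : d ≠ 0 := by rintro rfl; simp at hm; omega
    have hm0 : 0 < m := by
      rcases Nat.eq_zero_or_pos m with rfl | h
      · simp at hm; omega
      · exact h
    have hd2 : 2 ≤ d := by
      have := mt Nat.isUnit_iff.2 hu
      omega
    refine ⟨d, m, hm, hd0, hm0, ?_⟩
    have h2 : 2 * 2 ≤ d * d := Nat.mul_le_mul hd2 hd2
    nlinarith
  have sqA : ∀ (d : ℕ) (m x y : ℤ), d ≠ 0 → ∀ (K : Type) [Field K] [CharZero K],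
      Iso3 K (d * d * m) x y ↔ Iso3 K m x y := by
    intro d m x y hd K _ _
    rw [← sq]
    exact iso3_sq (d : ℤ) (by exact_mod_cast hd)
  by_cases sa : Squarefree a
  swap
  · obtain ⟨d, m, rfl, hd, hm, hlt⟩ := nsq a ha sa
    have key : ∀ (K : Type) [Field K] [CharZero K], Iso3 K (d * d * m : ℕ) b (-c) ↔ Iso3 K m b (-c) := by
      intro K _ _
      push_cast
      exact sqA d m b (-c) hd K
    rw [key]
    exact ih (m * b * c) (by gcongr) hm hb hc (fun p _ hp => (key _).1 (h p hp)) rfl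
  by_cases sb : Squarefree b
  swap
  · obtain ⟨d, m, rfl, hd, hm, hlt⟩ := nsq b hb sb
    have key : ∀ (K : Type) [Field K] [CharZero K], Iso3 K a (d * d * m : ℕ) (-c) ↔ Iso3 K a m (-c) := by
      intro K _ _
      push_cast
      exact ⟨fun h => ((sqA d m a (-c) hd K).1 h.swap).swap, fun h => ((sqA d m a (-c) hd K).2 h.swap).swap⟩
    rw [key]
    exact ih (a * m * c) (by gcongr) ha hm hc (fun p _ hp => (key _).1 (h p hp)) rfl
  by_cases sc : Squarefree c
  swap
  · obtain ⟨d, m, rfl, hd, hm, hlt⟩ := nsq c hc sc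
    have key : ∀ (K : Type) [Field K] [CharZero K], Iso3 K a b (-(d * d * m : ℕ)) ↔ Iso3 K a b (-m) := by
      intro K _ _
      push_cast
      rw [← mul_neg]
      exact ⟨fun h => ((sqA d (-m) a b hd K).1 h.rot.rot).rot, fun h => ((sqA d (-m) a b hd K).2 h.rot.rot).rot⟩
    rw [key]
    exact ih (a * b * m) (by gcongr) ha hb hm (fun p _ hp => (key _).1 (h p hp)) rfl
  by_cases hab : a.Coprime b
  swap
  · obtain ⟨r, hr, ⟨a', rfl⟩, ⟨b', rfl⟩⟩ := Nat.Prime.not_coprime_iff_dvd.1 hab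
    have key : ∀ (K : Type) [Field K] [CharZero K],
        Iso3 K (r * a' : ℕ) (r * b' : ℕ) (-c) ↔ Iso3 K a' b' (-(r * c : ℕ)) := by
      intro K _ _
      push_cast
      rw [iso3_move (r : ℤ) (by exact_mod_cast hr.ne_zero), mul_neg]
    rw [key]
    have ha' := Nat.pos_of_mul_pos_left ha
    have hb' := Nat.pos_of_mul_pos_left hb
    refine ih (a' * b' * (r * c)) ?_ ha' hb' (Nat.mul_pos hr.pos hc) (fun p _ hp => (key _).1 (h p hp)) rfl
    have h1 : 0 < a' * b' * (r * c) := by have := hr.pos; positivity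
    have h2 := hr.two_le
    calc a' * b' * (r * c) < r * (a' * b' * (r * c)) := by nlinarith
      _ = _ := by ring
  by_cases hac : a.Coprime c
  swap
  · obtain ⟨r, hr, ⟨a', rfl⟩, ⟨c', rfl⟩⟩ := Nat.Prime.not_coprime_iff_dvd.1 hac
    have key : ∀ (K : Type) [Field K] [CharZero K],
        Iso3 K (r * a' : ℕ) b (-(r * c' : ℕ)) ↔ Iso3 K a' (r * b : ℕ) (-c') := by
      intro K _ _
      push_cast
      rw [← mul_neg]
      have := iso3_move (K := K) (a := -c') (b := a') (c := b) (r : ℤ) (by exact_mod_cast hr.ne_zero)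
      exact ⟨fun h => (this.1 h.rot.rot).rot, fun h => (this.2 h.rot.rot).rot⟩
    rw [key]
    have ha' := Nat.pos_of_mul_pos_left ha
    have hc' := Nat.pos_of_mul_pos_left hc
    refine ih (a' * (r * b) * c') ?_ ha' (Nat.mul_pos hr.pos hb) hc' (fun p _ hp => (key _).1 (h p hp)) rfl
    have h1 : 0 < a' * (r * b) * c' := by have := hr.pos; positivity
    have h2 := hr.two_le
    calc a' * (r * b) * c' < r * (a' * (r * b) * c') := by nlinarith
      _ = _ := by ring
  by_cases hbc : b.Coprime c
  swap
  · obtain ⟨r, hr, ⟨a', rfl⟩, ⟨c', rfl⟩⟩ := Nat.Prime.not_coprime_iff_dvd.1 hbc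
    have key : ∀ (K : Type) [Field K] [CharZero K],
        Iso3 K a (r * a' : ℕ) (-(r * c' : ℕ)) ↔ Iso3 K (r * a : ℕ) a' (-c') := by
      intro K _ _
      push_cast
      rw [← mul_neg]
      have := iso3_move (K := K) (a := a') (b := -c') (c := a) (r : ℤ) (by exact_mod_cast hr.ne_zero)
      exact ⟨fun h => (this.1 h.rot).rot.rot, fun h => (this.2 h.rot).rot.rot⟩
    rw [key]
    have ha' := Nat.pos_of_mul_pos_left hb
    have hc' := Nat.pos_of_mul_pos_left hc
    refine ih (r * a * a' * c') ?_ (Nat.mul_pos hr.pos ha) ha' hc' (fun p _ hp => (key _).1 (h p hp)) rfl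
    have h1 : 0 < r * a * a' * c' := by have := hr.pos; positivity
    have h2 := hr.two_le
    calc r * a * a' * c' < r * (r * a * a' * c') := by nlinarith
      _ = _ := by ring
  exact ternary_coprime hq hq2 sa sb sc hab hac hbc h

end Bur

namespace Bur

theorem local_class {p : ℕ} [hp : Fact p.Prime] {x : ℚ_[p]} (hx : x ≠ 0) :
    ∃ e : ℕ, ∀ m : ℕ, ¬ p ∣ m → ∃ c : ℕ, c.Coprime p ∧ ∀ q : ℕ, q ≡ c [MOD p ^ 3] →
      ∃ t : ℚ_[p], t ≠ 0 ∧ ((p ^ e * m * q : ℕ) : ℚ_[p]) = x * t ^ 2 := by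
  have hp0 : (p : ℚ_[p]) ≠ 0 := by exact_mod_cast hp.out.ne_zero
  obtain ⟨k, e, hke⟩ : ∃ (k : ℤ) (e : ℕ), x.valuation = 2 * k + e :=
    ⟨x.valuation / 2, (x.valuation % 2).toNat, by omega⟩
  refine ⟨e, fun m hm => ?_⟩
  have hxn : ‖x * (p : ℚ_[p]) ^ (-x.valuation)‖ = 1 := by
    rw [norm_mul, Padic.norm_eq_zpow_neg_valuation hx, Padic.norm_p_zpow, neg_neg, ← zpow_add₀]
    · simp
    · exact_mod_cast hp.out.ne_zero
  have hmn : ‖(m : ℤ_[p])‖ = 1 := by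
    by_contra h
    have := lt_of_le_of_ne (PadicInt.norm_le_one _) h
    rw [PadicInt.norm_natCast_lt_one_iff] at this
    exact hm this
  obtain ⟨mu, hmu⟩ := PadicInt.isUnit_iff.2 hmn
  obtain ⟨u0, hu0⟩ : ∃ u0 : ℤ_[p], (u0 : ℚ_[p]) = x * (p : ℚ_[p]) ^ (-x.valuation) :=
    ⟨⟨_, hxn.le⟩, rfl⟩
  obtain ⟨u, hu⟩ : IsUnit u0 := PadicInt.isUnit_iff.2 (by rw [PadicInt.norm_def, hu0, hxn])
  set w : ℤ_[p]ˣ := mu⁻¹ * u with hw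
  refine ⟨PadicInt.appr (w : ℤ_[p]) 3, ?_, ?_⟩
  · rw [Nat.coprime_comm, hp.out.coprime_iff_not_dvd]
    intro hd
    have h1 := PadicInt.appr_spec 3 (w : ℤ_[p])
    have h2 : (p : ℤ_[p]) ∣ (w : ℤ_[p]) := by
      have h3 : (p : ℤ_[p]) ∣ (w : ℤ_[p]) - (PadicInt.appr (w : ℤ_[p]) 3 : ℕ) :=
        (dvd_pow_self _ (by norm_num)).trans (Ideal.mem_span_singleton.1 h1)
      have h4 : (p : ℤ_[p]) ∣ ((PadicInt.appr (w : ℤ_[p]) 3 : ℕ) : ℤ_[p]) := Nat.cast_dvd_cast hd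
      simpa using dvd_add h3 h4
    exact PadicInt.prime_p.not_isUnit (isUnit_of_dvd_unit h2 w.isUnit)
  · intro q hq
    have h1 := Ideal.mem_span_singleton.1 (PadicInt.appr_spec 3 (w : ℤ_[p]))
    have h2 : (p : ℤ_[p]) ^ 3 ∣ (w : ℤ_[p]) - q := by
      have h3 : (p : ℤ_[p]) ^ 3 ∣ ((PadicInt.appr (w : ℤ_[p]) 3 : ℕ) : ℤ_[p]) - q := by
        have := (Nat.modEq_iff_dvd.1 hq)
        have := Int.cast_dvd_cast (α := ℤ_[p]) _ _ this
        simpa using this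
      have := dvd_add h1 h3
      rwa [sub_add_sub_cancel] at this
    have h3 : (p : ℤ_[p]) ^ 3 ∣ ((w⁻¹ : ℤ_[p]ˣ) : ℤ_[p]) * q - 1 := by
      have := (h2.mul_left ((w⁻¹ : ℤ_[p]ˣ) : ℤ_[p])).neg_right
      rw [mul_sub, Units.inv_mul, neg_sub] at this
      exact this
    have h4 : ‖((w⁻¹ : ℤ_[p]ˣ) : ℤ_[p]) * q - 1‖ < ‖(2 : ℤ_[p])‖ ^ 2 := by
      obtain ⟨d, hd⟩ := h3
      rw [hd, norm_mul, norm_pow, PadicInt.norm_p]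
      have hd1 := PadicInt.norm_le_one d
      have hpp : (2 : ℝ) ≤ p := by exact_mod_cast hp.out.two_le
      have hi : ((p : ℝ)⁻¹) ≤ 1/2 := by
        rw [one_div]; exact inv_anti₀ (by norm_num) hpp
      have hi0 : 0 < ((p : ℝ)⁻¹) := by positivity
      have hlow : (p : ℝ)⁻¹ ≤ ‖(2 : ℤ_[p])‖ := by
        by_cases h2 : p = 2
        · subst h2
          have := PadicInt.norm_p (p := 2)
          simp only [Nat.cast_ofNat] at this
          rw [this]; simp
        · have : ‖((2 : ℕ) : ℤ_[p])‖ = 1 := by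
            by_contra h
            have := lt_of_le_of_ne (PadicInt.norm_le_one _) h
            rw [PadicInt.norm_natCast_lt_one_iff] at this
            exact h2 ((Nat.prime_dvd_prime_iff_eq hp.out Nat.prime_two).1 this)
          simp only [Nat.cast_ofNat] at this
          rw [this]; linarith
      calc ((p : ℝ)⁻¹) ^ 3 * ‖d‖ ≤ ((p : ℝ)⁻¹) ^ 3 * 1 := by gcongr
        _ < ((p : ℝ)⁻¹) ^ 2 := by nlinarith [pow_pos hi0 2]
        _ ≤ _ := by gcongr
    obtain ⟨t, ht⟩ := padic_isSquare_of_near h4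
    have h5 : ((m : ℤ_[p]) * q) = u * t ^ 2 := by
      have : (q : ℤ_[p]) = w * (((w⁻¹ : ℤ_[p]ˣ) : ℤ_[p]) * q) := by
        rw [← mul_assoc, Units.mul_inv, one_mul]
      rw [this, ht, ← hmu, hw, Units.val_mul, ← mul_assoc, ← mul_assoc, ← mul_assoc, Units.mul_inv]
      ring
    have ht0 : t ≠ 0 := by
      rintro rfl
      rw [mul_zero] at ht
      have hw0 := h3
      rw [ht] at hw0
      have : (p : ℤ_[p]) ∣ 1 := by
        have := (dvd_pow_self (p : ℤ_[p]) (by norm_num : (3:ℕ) ≠ 0)).trans hw0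
        simpa using this
      exact PadicInt.prime_p.not_isUnit (isUnit_of_dvd_one this)
    have h6 : (m : ℚ_[p]) * q = x * (p : ℚ_[p]) ^ (-x.valuation) * (t : ℚ_[p]) ^ 2 := by
      have := congrArg (fun z : ℤ_[p] => (z : ℚ_[p])) h5
      rw [hu] at this
      simpa [hu0] using this
    refine ⟨(p : ℚ_[p]) ^ (-k) * t, mul_ne_zero (zpow_ne_zero _ hp0) (by simpa using ht0), ?_⟩
    push_cast
    rw [mul_assoc, h6, hke]
    have : (p : ℚ_[p]) ^ e * (p : ℚ_[p]) ^ (-(2 * k + (e : ℤ))) = ((p : ℚ_[p]) ^ (-k)) ^ 2 := by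
      rw [← zpow_natCast, ← zpow_natCast, ← _root_.zpow_mul, ← zpow_add₀ hp0]; congr 1; push_cast; ring
    rw [mul_pow, ← this]
    ring

theorem approx (S : Finset ℕ) (hS : ∀ p ∈ S, p.Prime) (x : ∀ (p : ℕ) [Fact p.Prime], ℚ_[p])
    (hx : ∀ (p : ℕ) [Fact p.Prime], p ∈ S → x p ≠ 0) :
    ∃ X q : ℕ, 0 < X ∧ q.Prime ∧ q ∉ S ∧ (∀ r : ℕ, r.Prime → r ∣ X → r ∈ S ∨ r = q) ∧
      ∀ (p : ℕ) [Fact p.Prime], p ∈ S → ∃ t : ℚ_[p], t ≠ 0 ∧ (X : ℚ_[p]) = x p * t ^ 2 := by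
  classical
  have H1 : ∀ p : ℕ, ∃ e : ℕ, ∀ _ : Fact p.Prime, p ∈ S → ∀ m : ℕ, ¬ p ∣ m → ∃ c : ℕ, c.Coprime p ∧
      ∀ q : ℕ, q ≡ c [MOD p ^ 3] →
      ∃ t : ℚ_[p], t ≠ 0 ∧ ((p ^ e * m * q : ℕ) : ℚ_[p]) = x p * t ^ 2 := by
    intro p
    by_cases h : p ∈ S
    · have : Fact p.Prime := ⟨hS p h⟩
      obtain ⟨e, he⟩ := local_class (hx p h)
      exact ⟨e, fun _ _ => he⟩
    · exact ⟨0, fun _ h' => absurd h' h⟩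
  choose e he using H1
  have hnd : ∀ p ∈ S, ¬ p ∣ ∏ r ∈ S.erase p, r ^ e r := by
    intro p hp hd
    obtain ⟨r, hr, hrd⟩ := (hS p hp).prime.exists_mem_finset_dvd hd
    have h1 := (hS p hp).dvd_of_dvd_pow hrd
    have h2 := (Nat.prime_dvd_prime_iff_eq (hS p hp) (hS r (Finset.mem_of_mem_erase hr))).1 h1
    exact (Finset.ne_of_mem_erase hr) h2.symm
  have H2 : ∀ p : ℕ, ∃ c : ℕ, ∀ _ : Fact p.Prime, p ∈ S → c.Coprime p ∧
      ∀ q : ℕ, q ≡ c [MOD p ^ 3] →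
      ∃ t : ℚ_[p], t ≠ 0 ∧ ((p ^ e p * (∏ r ∈ S.erase p, r ^ e r) * q : ℕ) : ℚ_[p]) = x p * t ^ 2 := by
    intro p
    by_cases h : p ∈ S
    · have : Fact p.Prime := ⟨hS p h⟩
      obtain ⟨c, hc⟩ := he p this h _ (hnd p h)
      exact ⟨c, fun _ _ => hc⟩
    · exact ⟨0, fun _ h' => absurd h' h⟩
  choose c hc using H2
  have hpw : Set.Pairwise (S : Set ℕ) (Function.onFun Nat.Coprime fun p => p ^ 3) := by
    intro a ha b hb hab
    exact Nat.Coprime.pow _ _ ((Nat.coprime_primes (hS a ha) (hS b hb)).2 hab)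
  obtain ⟨d, hd⟩ := Nat.chineseRemainderOfFinset c (fun p => p ^ 3) S
    (fun p hp => pow_ne_zero _ (hS p hp).ne_zero) hpw
  have hd' : ∀ p ∈ S, d ≡ c p [MOD p ^ 3] := hd
  have hcop : d.Coprime (∏ p ∈ S, p ^ 3) := by
    refine Nat.Coprime.prod_right fun p hp => Nat.Coprime.pow_right _ ?_
    have : Fact p.Prime := ⟨hS p hp⟩
    have h1 := (hc p this hp).1
    have h2 : d ≡ c p [MOD p] := (hd' p hp).of_dvd (dvd_pow_self _ (by norm_num))
    unfold Nat.Coprime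
    rw [h2.gcd_eq]; exact h1
  obtain ⟨q, hqS, hq, hqm⟩ := Nat.forall_exists_prime_gt_and_modEq (S.sup id)
    (Finset.prod_ne_zero_iff.2 fun p hp => pow_ne_zero _ (hS p hp).ne_zero) hcop
  refine ⟨(∏ p ∈ S, p ^ e p) * q, q, ?_, hq, ?_, ?_, ?_⟩
  · exact Nat.mul_pos (Finset.prod_pos fun p hp => pow_pos (hS p hp).pos _) hq.pos
  · intro h
    have := Finset.le_sup (f := id) h
    simp only [id] at this; omega
  · intro r hr hrd
    rcases (hr.dvd_mul).1 hrd with h | h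
    · obtain ⟨s, hs, hsd⟩ := hr.prime.exists_mem_finset_dvd h
      have := (Nat.prime_dvd_prime_iff_eq hr (hS s hs)).1 (hr.dvd_of_dvd_pow hsd)
      exact Or.inl (this ▸ hs)
    · exact Or.inr ((Nat.prime_dvd_prime_iff_eq hr hq).1 h)
  · intro p hp hpS
    rw [← Finset.mul_prod_erase S (fun r => r ^ e r) hpS]
    exact (hc p hp hpS).2 q ((hqm.of_dvd (Finset.dvd_prod_of_mem _ hpS)).trans (hd' p hpS))
end Bur

namespace Bur

/-- isotropy of a diagonal form -/
def Iso (K : Type*) [Field K] {ι : Type*} [Fintype ι] (F : ι → ℤ) : Prop :=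
  ∃ x : ι → K, x ≠ 0 ∧ ∑ i, (F i : K) * x i ^ 2 = 0

/-- common value of two diagonal forms -/
def Iso2 (K : Type*) [Field K] {r s : ℕ} (f : Fin r → ℕ) (g : Fin s → ℕ) : Prop :=
  ∃ (x : Fin r → K) (y : Fin s → K), (x ≠ 0 ∨ y ≠ 0) ∧
    ∑ i, (f i : K) * x i ^ 2 = ∑ j, (g j : K) * y j ^ 2

theorem Iso2.symm {K : Type*} [Field K] {r s : ℕ} {f : Fin r → ℕ} {g : Fin s → ℕ}
    (h : Iso2 K f g) : Iso2 K g f := by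
  obtain ⟨x, y, h, h'⟩ := h
  exact ⟨y, x, h.symm, h'.symm⟩

theorem Iso.toIso2 {K : Type*} [Field K] {r s : ℕ} {f : Fin r → ℕ} {g : Fin s → ℕ}
    (h : Iso K (Sum.elim (fun i => (f i : ℤ)) (fun j => -(g j : ℤ)))) : Iso2 K f g := by
  obtain ⟨x, hx, h⟩ := h
  refine ⟨fun i => x (Sum.inl i), fun j => x (Sum.inr j), ?_, ?_⟩
  · by_contra hc
    push Not at hc
    apply hx
    funext i
    rcases i with i | j
    · exact congrFun hc.1 i
    · exact congrFun hc.2 j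
  · rw [Fintype.sum_sum_type] at h
    simp only [Sum.elim_inl, Sum.elim_inr, Int.cast_neg, Int.cast_natCast, neg_mul,
      Finset.sum_neg_distrib] at h
    linear_combination h

theorem Iso.of_comp {K : Type*} [Field K] {ι κ : Type*} [Fintype ι] [Fintype κ] {F : κ → ℤ}
    (e : ι → κ) (he : Function.Injective e) (h : Iso K (F ∘ e)) : Iso K F := by
  obtain ⟨x, hx, h⟩ := h
  refine ⟨Function.extend e x 0, ?_, ?_⟩
  · intro h0
    apply hx
    funext i
    have := congrFun h0 (e i)
    rwa [he.extend_apply] at this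
  · rw [← h]
    symm
    apply Fintype.sum_of_injective e he
    · intro i hi
      rw [Function.extend_apply' _ _ _ (by simpa using hi)]
      simp
    · intro i
      rw [he.extend_apply]; rfl

theorem iso_good {p : ℕ} [hp : Fact p.Prime] (hp2 : p ≠ 2) {ι : Type*} [Fintype ι] {F : ι → ℤ}
    (A : Finset ι) (hA : 2 < A.card) (h : ∀ i ∈ A, ¬ (p : ℤ) ∣ F i) : Iso ℚ_[p] F := by
  obtain ⟨i, j, k, hi, hj, hk, hij, hik, hjk⟩ := Finset.two_lt_card_iff.1 hA
  have h3 := iso3_good hp2 (h i hi) (h j hj) (h k hk)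
  apply Iso.of_comp ![i, j, k]
  · intro a b hab
    fin_cases a <;> fin_cases b <;> simp_all
  · obtain ⟨x, y, z, hn, he⟩ := h3
    refine ⟨![x, y, z], ?_, ?_⟩
    · intro h0
      have h1 := congrFun h0 0
      have h2 := congrFun h0 1
      have h3 := congrFun h0 2
      simp at h1 h2 h3
      tauto
    · simp [Fin.sum_univ_three, he]

theorem iso2_split {K : Type*} [Field K] [CharZero K] {k s : ℕ} {f : Fin (k+2) → ℕ}
    {g : Fin (s+1) → ℕ} (hf : ∀ i, 0 < f i) (hg : ∀ i, 0 < g i) (h : Iso2 K f g) :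
    ∃ x : K, x ≠ 0 ∧ ∀ X : ℕ, (∃ t : K, t ≠ 0 ∧ (X : K) = x * t ^ 2) →
      Iso3 K (f 0) (f 1) (-X) ∧
      Iso2 K (Fin.cons X (fun i : Fin k => f i.succ.succ) : Fin (k+1) → ℕ) g := by
  suffices H : ∃ x : K, x ≠ 0 ∧ (∃ u v z : K, (u ≠ 0 ∨ v ≠ 0 ∨ z ≠ 0) ∧
      (f 0 : K) * u ^ 2 + f 1 * v ^ 2 = x * z ^ 2) ∧
      ∃ (t : K) (x' : Fin k → K) (y : Fin (s+1) → K), (t ≠ 0 ∨ x' ≠ 0 ∨ y ≠ 0) ∧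
        x * t ^ 2 + ∑ i : Fin k, (f i.succ.succ : K) * x' i ^ 2 = ∑ j, (g j : K) * y j ^ 2 by
    obtain ⟨x, hx, ⟨u, v, z, hn, h1⟩, t, x', y, hn2, h2⟩ := H
    refine ⟨x, hx, fun X ⟨w, hw, hX⟩ => ⟨⟨u, v, z / w, ?_, ?_⟩, Fin.cons (t / w) x', y, ?_, ?_⟩⟩
    · rcases hn with h | h | h
      · exact Or.inl h
      · exact Or.inr (Or.inl h)
      · exact Or.inr (Or.inr (div_ne_zero h hw))
    · push_cast
      rw [hX]
      field_simp
      linear_combination h1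
    · by_contra hc
      push Not at hc
      obtain ⟨c1, c2⟩ := hc
      rcases hn2 with h | h | h
      · have := congrFun c1 0
        simp only [Fin.cons_zero, Pi.zero_apply] at this
        exact div_ne_zero h hw this
      · apply h
        funext i
        have := congrFun c1 i.succ
        simpa using this
      · exact h c2
    · rw [Fin.sum_univ_succ]
      simp only [Fin.cons_zero, Fin.cons_succ]
      rw [← h2, hX]
      congr 1
      field_simp
  obtain ⟨x, y, hn, h⟩ := h
  rw [Fin.sum_univ_succ, Fin.sum_univ_succ, ← add_assoc] at h
  simp only [Fin.succ_zero_eq_one] at h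
  by_cases h0 : (f 0 : K) * x 0 ^ 2 + f 1 * x 1 ^ 2 = 0
  · by_cases h1 : x 0 = 0 ∧ x 1 = 0
    · refine ⟨f 0, by exact_mod_cast (hf 0).ne', ⟨1, 0, 1, by simp, by simp⟩,
        0, fun i => x i.succ.succ, y, ?_, ?_⟩
      · rcases hn with hn | hn
        · right; left
          intro hc
          apply hn
          funext i
          refine Fin.cases h1.1 (fun i => ?_) i
          refine Fin.cases h1.2 (fun i => ?_) i
          exact congrFun hc i
        · exact Or.inr (Or.inr hn)
      · rw [← h, h0]; simp
    · refine ⟨g 0, by exact_mod_cast (hg 0).ne', ⟨x 0, x 1, 0, by tauto, by simp [h0]⟩,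
        1, 0, Pi.single 0 1, by simp, ?_⟩
      rw [Fin.sum_univ_succ]
      simp
  · exact ⟨_, h0, ⟨x 0, x 1, 1, by simp, by simp⟩, 1, fun i => x i.succ.succ, y, by simp,
      by rw [← h]; simp⟩

theorem iso2_combine {k s : ℕ} {f : Fin (k+2) → ℕ}
    {g : Fin s → ℕ} (hf : ∀ i, 0 < f i) {X : ℕ} (hX : 0 < X)
    (h1 : Iso3 ℚ (f 0) (f 1) (-X))
    (h2 : Iso2 ℚ (Fin.cons X (fun i : Fin k => f i.succ.succ) : Fin (k+1) → ℕ) g) :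
    Iso2 ℚ f g := by
  obtain ⟨u, v, z, hn, h1⟩ := h1
  obtain ⟨x, y, hn2, h2⟩ := h2
  push_cast at h1
  have f0 : (0 : ℚ) < f 0 := by exact_mod_cast hf 0
  have f1 : (0 : ℚ) < f 1 := by exact_mod_cast hf 1
  have hz : z ≠ 0 := by
    rintro rfl
    have hu : u = 0 := by
      have : (f 0 : ℚ) * u ^ 2 = 0 := by nlinarith [mul_nonneg f0.le (sq_nonneg u), mul_nonneg f1.le (sq_nonneg v)]
      simpa [f0.ne'] using this
    have hv : v = 0 := by
      have : (f 1 : ℚ) * v ^ 2 = 0 := by nlinarith [mul_nonneg f0.le (sq_nonneg u), mul_nonneg f1.le (sq_nonneg v)]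
      simpa [f1.ne'] using this
    simp_all
  rw [Fin.sum_univ_succ] at h2
  simp only [Fin.cons_zero, Fin.cons_succ] at h2
  refine ⟨Fin.cons (u / z * x 0) (Fin.cons (v / z * x 0) (fun i => x i.succ)), y, ?_, ?_⟩
  · by_contra hc
    push Not at hc
    obtain ⟨c1, c2⟩ := hc
    rcases hn2 with hn2 | hn2
    · have a0 := congrFun c1 0
      have a1 := congrFun c1 1
      simp only [Fin.cons_zero, Pi.zero_apply, Fin.cons_one] at a0 a1
      have hx0 : x 0 = 0 := by
        by_contra hx
        have hu : u = 0 := by simpa [hz, hx] using a0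
        have hv : v = 0 := by simpa [hz, hx] using a1
        subst hu hv
        have : (X : ℚ) ≠ 0 := by exact_mod_cast hX.ne'
        simp [this, hz] at h1
      apply hn2
      funext i
      refine Fin.cases hx0 (fun i => ?_) i
      have := congrFun c1 i.succ.succ
      simpa using this
    · exact hn2 c2
  · rw [Fin.sum_univ_succ, Fin.sum_univ_succ, ← h2]
    simp only [Fin.cons_zero, Fin.cons_succ, Fin.succ_zero_eq_one, Fin.cons_one]
    rw [← add_assoc]
    congr 1
    field_simp
    linear_combination (x 0)^2 * h1
end Bur

namespace Bur

theorem hm_step {k s N : ℕ} {f : Fin (k+2) → ℕ} {g : Fin (s+1) → ℕ} (hf : ∀ i, 0 < f i)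
    (hg : ∀ i, 0 < g i) (hN : k + s = N + 1)
    (h : ∀ (p : ℕ) [Fact p.Prime], Iso2 ℚ_[p] f g)
    (IH : ∀ (f : Fin (k+1) → ℕ), (∀ i, 0 < f i) → ∀ q : ℕ, q.Prime →
      (∀ (p : ℕ) [Fact p.Prime], (p ≠ q ∨ N ≠ 0) → Iso2 ℚ_[p] f g) → Iso2 ℚ f g) :
    Iso2 ℚ f g := by
  classical
  set S : Finset ℕ := insert 2 ((∏ i, f i) * ∏ j, g j).primeFactors with hS
  have hne : (∏ i, f i) * ∏ j, g j ≠ 0 :=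
    mul_ne_zero (Finset.prod_ne_zero_iff.2 fun i _ => (hf i).ne')
      (Finset.prod_ne_zero_iff.2 fun i _ => (hg i).ne')
  have hSp : ∀ p ∈ S, p.Prime := by
    intro p hp
    rcases Finset.mem_insert.1 hp with rfl | hp
    · exact Nat.prime_two
    · exact Nat.prime_of_mem_primeFactors hp
  have hSf : ∀ p : ℕ, p.Prime → p ∉ S → ∀ i, ¬ p ∣ f i := by
    intro p hp hpS i hd
    refine hpS (Finset.mem_insert_of_mem (Nat.mem_primeFactors.2 ⟨hp, ?_, hne⟩))
    exact (hd.trans (Finset.dvd_prod_of_mem f (Finset.mem_univ i))).mul_right _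
  have hSg : ∀ p : ℕ, p.Prime → p ∉ S → ∀ i, ¬ p ∣ g i := by
    intro p hp hpS i hd
    refine hpS (Finset.mem_insert_of_mem (Nat.mem_primeFactors.2 ⟨hp, ?_, hne⟩))
    exact (hd.trans (Finset.dvd_prod_of_mem g (Finset.mem_univ i))).mul_left _
  choose x hx hX using fun (p : ℕ) (hp : Fact p.Prime) => iso2_split hf hg (h p)
  obtain ⟨X, q, hX0, hq, hqS, hXd, hXx⟩ := approx S hSp (fun p hp => x p hp) (fun p hp _ => hx p hp)
  have hS2 : 2 ∈ S := Finset.mem_insert_self _ _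
  have hXg : ∀ p : ℕ, p.Prime → p ∉ S → p ≠ q → ¬ p ∣ X := by
    intro p hp hpS hpq hd
    rcases hXd p hp hd with h | h
    · exact hpS h
    · exact hpq h
  refine iso2_combine hf hX0 ?_ (IH _ ?_ q hq ?_)
  · refine ternary hq (hf 0) (hf 1) hX0 fun p hp hpq => ?_
    by_cases hpS : p ∈ S
    · exact (hX p hp X (hXx p hpS)).1
    · refine iso3_good (by rintro rfl; exact hpS hS2) ?_ ?_ ?_
      · exact_mod_cast hSf p hp.out hpS 0
      · exact_mod_cast hSf p hp.out hpS 1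
      · rw [dvd_neg]; exact_mod_cast hXg p hp.out hpS hpq
  · intro i
    refine Fin.cases hX0 (fun i => ?_) i
    exact hf _
  · intro p hp hpq
    by_cases hpS : p ∈ S
    · exact (hX p hp X (hXx p hpS)).2
    · apply Iso.toIso2
      have p2 : p ≠ 2 := by rintro rfl; exact hpS hS2
      have key : ∀ i : Fin (k+1) ⊕ Fin (s+1), i ≠ Sum.inl 0 →
          ¬ (p : ℤ) ∣ (Sum.elim (fun i => (((Fin.cons X fun i : Fin k => f i.succ.succ : Fin (k+1) → ℕ) i : ℕ) : ℤ)) (fun j => -(g j : ℤ)) i) := by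
        intro i hi
        rcases i with i | j
        · obtain ⟨i, rfl⟩ := Fin.exists_succ_eq_of_ne_zero (x := i) (fun h => hi (by rw [h]))
          simp only [Sum.elim_inl, Fin.cons_succ]
          exact_mod_cast hSf p hp.out hpS _
        · simp only [Sum.elim_inr, dvd_neg]
          exact_mod_cast hSg p hp.out hpS _
      by_cases hpq' : p = q
      · refine iso_good p2 (Finset.univ.erase (Sum.inl 0)) ?_ ?_
        · rw [Finset.card_erase_of_mem (Finset.mem_univ _)]
          have : N ≠ 0 := hpq.resolve_left (fun h => h hpq')
          simp; omega
        · intro i hi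
          exact key i (Finset.ne_of_mem_erase hi)
      · refine iso_good p2 Finset.univ ?_ ?_
        · simp; omega
        · intro i _
          by_cases hi : i = Sum.inl 0
          · subst hi
            simp only [Sum.elim_inl, Fin.cons_zero]
            exact_mod_cast hXg p hp.out hpS hpq'
          · exact key i hi

theorem iso2_21 {K : Type*} [Field K] {f : Fin 2 → ℕ} {g : Fin 1 → ℕ} :
    Iso2 K f g ↔ Iso3 K (f 0) (f 1) (-(g 0 : ℕ)) := by
  constructor
  · rintro ⟨x, y, hn, h⟩
    refine ⟨x 0, x 1, y 0, ?_, ?_⟩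
    · by_contra hc
      push Not at hc
      rcases hn with h | h <;> apply h <;> funext i <;> fin_cases i <;> simp [hc]
    · simp [Fin.sum_univ_two] at h
      push_cast
      linear_combination h
  · rintro ⟨x, y, z, hn, h⟩
    refine ⟨![x, y], ![z], ?_, ?_⟩
    · by_contra hc
      push Not at hc
      have h1 := congrFun hc.1 0
      have h2 := congrFun hc.1 1
      have h3 := congrFun hc.2 0
      simp at h1 h2 h3
      tauto
    · push_cast at h
      simp [Fin.sum_univ_two]
      linear_combination h

theorem hm_aux (N : ℕ) : ∀ (r s : ℕ) (f : Fin (r+1) → ℕ) (g : Fin (s+1) → ℕ),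
    r + s = N + 1 → (∀ i, 0 < f i) → (∀ i, 0 < g i) → ∀ q : ℕ, q.Prime →
    (∀ (p : ℕ) [Fact p.Prime], (p ≠ q ∨ N ≠ 0) → Iso2 ℚ_[p] f g) → Iso2 ℚ f g := by
  induction N with
  | zero =>
    intro r s f g hrs hf hg q hq h
    obtain ⟨rfl, rfl⟩ | ⟨rfl, rfl⟩ : (r = 1 ∧ s = 0) ∨ (r = 0 ∧ s = 1) := by omega
    · rw [iso2_21]
      exact ternary hq (hf 0) (hf 1) (hg 0) fun p hp hpq => iso2_21.1 (h p (Or.inl hpq))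
    · apply Iso2.symm
      rw [iso2_21]
      exact ternary hq (hg 0) (hg 1) (hf 0) fun p hp hpq => iso2_21.1 (h p (Or.inl hpq)).symm
  | succ N IH =>
    intro r s f g hrs hf hg q hq h
    have h' : ∀ (p : ℕ) [Fact p.Prime], Iso2 ℚ_[p] f g := fun p _ => h p (Or.inr (by omega))
    rcases Nat.eq_zero_or_pos r with rfl | hr
    · obtain ⟨s, rfl⟩ : ∃ t, s = t + 1 := ⟨s - 1, by omega⟩
      apply Iso2.symm
      refine hm_step (N := N) hg hf (by omega) (fun p _ => (h' p).symm) ?_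
      intro g' hg' q hq hh
      exact IH _ _ _ _ (by omega) hg' hf q hq hh
    · obtain ⟨r, rfl⟩ : ∃ t, r = t + 1 := ⟨r - 1, by omega⟩
      refine hm_step (N := N) hf hg (by omega) h' ?_
      intro g' hg' q hq hh
      exact IH _ _ _ _ (by omega) hg' hg q hq hh

theorem nat_isSquare {n : ℕ} (hn : 0 < n) (h : ∀ (p : ℕ) [Fact p.Prime], IsSquare (n : ℚ_[p])) :
    IsSquare n := by
  have he : ∀ p, Even (n.factorization p) := by
    intro p
    by_cases hp : p.Prime
    · have : Fact p.Prime := ⟨hp⟩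
      obtain ⟨t, ht⟩ := h p
      have hn0 : (n : ℚ_[p]) ≠ 0 := by exact_mod_cast hn.ne'
      have ht0 : t ≠ 0 := by rintro rfl; simp at ht; omega
      have h1 := congrArg Padic.valuation ht
      rw [Padic.valuation_mul ht0 ht0, Padic.valuation_natCast] at h1
      rw [Nat.factorization_def _ hp, ← Int.even_coe_nat, h1]
      exact ⟨_, rfl⟩
    · rw [Nat.factorization_eq_zero_of_not_prime _ hp]; simp
  refine ⟨n.factorization.prod fun p e => p ^ (e / 2), ?_⟩
  conv_lhs => rw [← Nat.prod_factorization_pow_eq_self hn.ne']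
  rw [← Finsupp.prod_mul]
  refine Finsupp.prod_congr fun p _ => ?_
  rw [← pow_add]
  congr 1
  obtain ⟨k, hk⟩ := he p
  omega

theorem hm {r s : ℕ} {f : Fin (r+1) → ℕ} {g : Fin (s+1) → ℕ} (hf : ∀ i, 0 < f i)
    (hg : ∀ i, 0 < g i) (h : ∀ (p : ℕ) [Fact p.Prime], Iso2 ℚ_[p] f g) : Iso2 ℚ f g := by
  by_cases h0 : r + s = 0
  · obtain ⟨rfl, rfl⟩ : r = 0 ∧ s = 0 := by omega
    have h1 : IsSquare (f 0 * g 0) := by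
      refine nat_isSquare (Nat.mul_pos (hf 0) (hg 0)) fun p hp => ?_
      obtain ⟨x, y, hn, h⟩ := h p
      simp at h
      have f0 : (f 0 : ℚ_[p]) ≠ 0 := by exact_mod_cast (hf 0).ne'
      have g0 : (g 0 : ℚ_[p]) ≠ 0 := by exact_mod_cast (hg 0).ne'
      have hx : x 0 ≠ 0 := by
        intro hx
        rw [hx] at h
        have hy : y 0 = 0 := by
          have : (g 0 : ℚ_[p]) * y 0 ^ 2 = 0 := by rw [← h]; simp
          simpa [g0] using this
        rcases hn with h | h <;> apply h <;> funext i <;> fin_cases i <;> simp [hx, hy]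
      refine ⟨g 0 * y 0 / x 0, ?_⟩
      push_cast
      field_simp
      linear_combination h
    obtain ⟨t, ht⟩ := h1
    have ht' : (f 0 : ℚ) * g 0 = t * t := by exact_mod_cast ht
    refine ⟨fun _ => g 0, fun _ => t, ?_, ?_⟩
    · left
      intro hc
      have := congrFun hc 0
      have := hg 0
      simp_all
    · simp
      linear_combination (g 0 : ℚ) * ht'
  · exact hm_aux (r + s - 1) r s f g (by omega) hf hg 2 Nat.prime_two (fun p _ _ => h p)
end Bur

namespace Bur
open Matrix

theorem sum_pos_zero {m : ℕ} {f : Fin m → ℚ} (hf : ∀ i, 0 < f i) {x : Fin m → ℚ}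
    (h : ∑ i, f i * x i ^ 2 = 0) : x = 0 := by
  funext i
  have := (Finset.sum_eq_zero_iff_of_nonneg
    (fun i _ => mul_nonneg (hf i).le (sq_nonneg (x i)))).1 h i (Finset.mem_univ i)
  simpa [(hf i).ne'] using this

theorem hm_rat {m : ℕ} {f g : Fin (m+1) → ℚ} (hf : ∀ i, 0 < f i)
    (hg : ∀ i, 0 < g i)
    (h : ∀ (p : ℕ) [Fact p.Prime], ∃ x y : Fin (m+1) → ℚ_[p], (x ≠ 0 ∨ y ≠ 0) ∧
      ∑ i, (f i : ℚ_[p]) * x i ^ 2 = ∑ i, (g i : ℚ_[p]) * y i ^ 2) :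
    ∃ x y : Fin (m+1) → ℚ, x ≠ 0 ∧ y ≠ 0 ∧ ∑ i, f i * x i ^ 2 = ∑ i, g i * y i ^ 2 := by
  have key : ∀ {K : Type} [Field K] [CharZero K] (f : Fin (m+1) → ℚ), (∀ i, 0 < f i) →
      ∀ i, (((f i).num.toNat * (f i).den : ℕ) : K) = (f i : K) * ((f i).den : K) ^ 2 := by
    intro K _ _ f hf i
    have h1 : (((f i).num.toNat : ℤ)) = (f i).num := Int.toNat_of_nonneg (Rat.num_pos.2 (hf i)).le
    have h2 : ((f i).num.toNat : K) = ((f i).num : K) := by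
      exact_mod_cast congrArg (Int.cast : ℤ → K) h1
    have h3 : ((f i).den : K) ≠ 0 := by exact_mod_cast (f i).den_ne_zero
    push_cast
    rw [h2]
    conv_rhs => rw [Rat.cast_def]
    field_simp
  have pos : ∀ f : Fin (m+1) → ℚ, (∀ i, 0 < f i) → ∀ i, 0 < (f i).num.toNat * (f i).den := by
    intro f hf i
    have := Rat.num_pos.2 (hf i)
    exact Nat.mul_pos (by omega) (f i).den_pos
  have hden : ∀ {K : Type} [Field K] [CharZero K] (r : ℚ), (r.den : K) ≠ 0 := by
    intro K _ _ r; exact_mod_cast r.den_ne_zero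
  obtain ⟨x, y, hn, he⟩ := hm (pos f hf) (pos g hg) (fun p hp => by
    obtain ⟨x, y, hn, he⟩ := h p
    refine ⟨fun i => x i / (f i).den, fun i => y i / (g i).den, ?_, ?_⟩
    · rcases hn with hn | hn
      · left
        intro hc
        apply hn
        funext i
        simpa [hden] using congrFun hc i
      · right
        intro hc
        apply hn
        funext i
        simpa [hden] using congrFun hc i
    · simp_rw [key f hf, key g hg]
      convert he using 2
      · rename_i i _
        have := hden (K := ℚ_[p]) (f i)
        field_simp
      · rename_i i _
        have := hden (K := ℚ_[p]) (g i)
        field_simp)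
  simp_rw [key f hf, key g hg] at he
  have he' : ∑ i, f i * ((f i).den * x i) ^ 2 = ∑ i, g i * ((g i).den * y i) ^ 2 := by
    simpa [mul_pow, mul_assoc] using he
  have hx : x ≠ 0 := by
    rintro rfl
    simp at he'
    have := sum_pos_zero hg (x := fun i => (g i).den * y i) he'.symm
    rcases hn with h | h
    · exact h rfl
    · apply h
      funext i
      simpa using congrFun this i
  have hy : y ≠ 0 := by
    rintro rfl
    simp at he'
    have := sum_pos_zero hf (x := fun i => (f i).den * x i) he'
    rcases hn with h | h
    · apply h
      funext i
      simpa using congrFun this i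
    · exact h rfl
  refine ⟨_, _, ?_, ?_, he'⟩
  · intro hc
    apply hx
    funext i
    simpa using congrFun hc i
  · intro hc
    apply hy
    funext i
    simpa using congrFun hc i

/-- rational positive definite -/
def PD {ι : Type*} [Fintype ι] (A : Matrix ι ι ℚ) : Prop :=
  A.IsSymm ∧ ∀ x : ι → ℚ, x ≠ 0 → 0 < x ⬝ᵥ A *ᵥ x

theorem split {m : ℕ} {A : Matrix (Fin (m+1)) (Fin (m+1)) ℚ} (hA : PD A) {v : Fin (m+1) → ℚ}
    (hv : v ≠ 0) : ∃ (P P' : Matrix (Fin (m+1)) (Fin (m+1)) ℚ) (f : Fin m → ℚ), P * P' = 1 ∧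
      (∀ i, 0 < f i) ∧ Pᵀ * A * P = diagonal (Fin.cons (v ⬝ᵥ A *ᵥ v) f) := by
  obtain ⟨w, hw0, hwv, hww⟩ : ∃ w : Fin m → (Fin (m+1) → ℚ), (∀ i, w i ≠ 0) ∧
      (∀ i, v ⬝ᵥ A *ᵥ w i = 0) ∧ ∀ i j, i ≠ j → w i ⬝ᵥ A *ᵥ w j = 0 := by
    set B := Matrix.toBilin' A with hB
    have hBa : ∀ x y, B x y = x ⬝ᵥ A *ᵥ y := fun x y => Matrix.toBilin'_apply' A x y
    have hBs : B.IsSymm := by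
      refine ⟨fun x y => ?_⟩
      rw [hBa, hBa, dotProduct_comm, ← vecMul_transpose, hA.1.eq, ← dotProduct_mulVec]
    set W := LinearMap.ker (B v) with hW
    have hBv : B v ≠ 0 := by
      intro h
      have h1 := hA.2 v hv
      rw [← hBa, h] at h1
      simp at h1
    have hfr : Module.finrank ℚ W = m := by
      have := Module.Dual.finrank_ker_add_one_of_ne_zero (f := B v) hBv
      rw [Module.finrank_fin_fun] at this
      exact Nat.succ_injective this
    obtain ⟨b, hb⟩ := LinearMap.BilinForm.exists_orthogonal_basis (B := B.restrict W)
      (by refine ⟨fun x y => ?_⟩; exact hBs.eq _ _)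
    refine ⟨fun i => (b (finCongr hfr.symm i) : Fin (m+1) → ℚ), ?_, ?_, ?_⟩
    · intro i hc
      exact b.ne_zero _ (Subtype.ext hc)
    · intro i
      rw [← hBa]
      exact (b (finCongr hfr.symm i)).2
    · intro i j hij
      rw [← hBa]
      exact hb (by simpa using hij)
  set P : Matrix (Fin (m+1)) (Fin (m+1)) ℚ := (Matrix.of (Fin.cons v w : Fin (m+1) → Fin (m+1) → ℚ))ᵀ with hP
  have hsym : ∀ x y : Fin (m+1) → ℚ, x ⬝ᵥ A *ᵥ y = y ⬝ᵥ A *ᵥ x := by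
    intro x y
    rw [dotProduct_comm, ← vecMul_transpose, hA.1.eq, ← dotProduct_mulVec]
  have hent : ∀ i j, (Pᵀ * A * P) i j = (Fin.cons v w : Fin (m+1) → Fin (m+1) → ℚ) i ⬝ᵥ A *ᵥ
      (Fin.cons v w : Fin (m+1) → Fin (m+1) → ℚ) j := by
    intro i j
    rw [Matrix.mul_assoc]
    rfl
  have hgram : Pᵀ * A * P = diagonal (Fin.cons (v ⬝ᵥ A *ᵥ v) (fun i => w i ⬝ᵥ A *ᵥ w i)) := by
    ext i j
    rw [hent]
    refine Fin.cases ?_ (fun i => ?_) i <;> refine Fin.cases ?_ (fun j => ?_) j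
    · simp
    · rw [diagonal_apply_ne _ (Fin.succ_ne_zero _).symm]
      simpa using hwv j
    · rw [diagonal_apply_ne _ (Fin.succ_ne_zero _)]
      rw [hsym]
      simpa using hwv i
    · by_cases hij : i = j
      · subst hij
        simp
      · rw [diagonal_apply_ne _ (by simpa using hij)]
        simpa using hww i j hij
  have hpos : ∀ i, 0 < w i ⬝ᵥ A *ᵥ w i := fun i => hA.2 _ (hw0 i)
  have hdet : IsUnit P.det := by
    rw [isUnit_iff_ne_zero]
    intro h
    have h1 := congrArg Matrix.det hgram
    rw [det_mul, h, mul_zero, det_diagonal] at h1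
    have : 0 < ∏ i, (Fin.cons (v ⬝ᵥ A *ᵥ v) (fun i => w i ⬝ᵥ A *ᵥ w i) : Fin (m+1) → ℚ) i := by
      refine Finset.prod_pos fun i _ => ?_
      refine Fin.cases ?_ (fun i => ?_) i
      · exact hA.2 v hv
      · exact hpos i
    rw [← h1] at this
    exact lt_irrefl _ this
  exact ⟨P, P⁻¹, _, Matrix.mul_nonsing_inv _ hdet, hpos, hgram⟩

theorem pd_diag {m : ℕ} {f : Fin m → ℚ} (hf : ∀ i, 0 < f i) : PD (diagonal f) := by
  refine ⟨Matrix.isSymm_diagonal f, fun x hx => ?_⟩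
  have : x ⬝ᵥ diagonal f *ᵥ x = ∑ i, f i * x i ^ 2 := by
    simp only [dotProduct, mulVec_diagonal]
    exact Finset.sum_congr rfl fun i _ => by ring
  rw [this]
  refine lt_of_le_of_ne (Finset.sum_nonneg fun i _ => mul_nonneg (hf i).le (sq_nonneg _)) ?_
  intro h
  exact hx (sum_pos_zero hf h.symm)
end Bur

namespace Bur
open Matrix

/-- local hypothesis -/
def Loc {m : ℕ} (n : ℕ) (A B : Matrix (Fin m) (Fin m) ℚ) : Prop :=
  ∀ (p : ℕ) [Fact p.Prime], ∃ T : Submodule ℚ_[p] ((Fin m → ℚ_[p]) × (Fin m → ℚ_[p])),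
    2 * m ≤ Module.finrank ℚ_[p] T + n ∧
    ∀ z ∈ T, z.1 ⬝ᵥ A.map (Rat.cast : ℚ → ℚ_[p]) *ᵥ z.1 = z.2 ⬝ᵥ B.map (Rat.cast : ℚ → ℚ_[p]) *ᵥ z.2

/-- global conclusion -/
def Glob {m : ℕ} (n : ℕ) (A B : Matrix (Fin m) (Fin m) ℚ) : Prop :=
  ∃ (ι : Type) (_ : Fintype ι) (_ : DecidableEq ι) (d : ι → ℚ) (S₁ S₂ : Matrix ι (Fin m) ℚ),
    Fintype.card ι = n ∧ (∀ i, 0 < d i) ∧ S₁ᵀ * diagonal d * S₁ = A ∧ S₂ᵀ * diagonal d * S₂ = B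

theorem glob_transport {m n : ℕ} {A B P P' Q Q' : Matrix (Fin m) (Fin m) ℚ} (hP : P * P' = 1)
    (hQ : Q * Q' = 1) (h : Glob n (Pᵀ * A * P) (Qᵀ * B * Q)) : Glob n A B := by
  obtain ⟨ι, i1, i2, d, S₁, S₂, hc, hd, h1, h2⟩ := h
  have key : ∀ {A P P' : Matrix (Fin m) (Fin m) ℚ} {S : Matrix ι (Fin m) ℚ}, P * P' = 1 →
      Sᵀ * diagonal d * S = Pᵀ * A * P → (S * P')ᵀ * diagonal d * (S * P') = A := by
    intro A P P' S hP h
    have hP2 : P'ᵀ * Pᵀ = 1 := by rw [← transpose_mul, hP, transpose_one]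
    calc (S * P')ᵀ * diagonal d * (S * P') = P'ᵀ * (Sᵀ * diagonal d * S) * P' := by
          rw [transpose_mul]; simp only [Matrix.mul_assoc]
      _ = (P'ᵀ * Pᵀ) * A * (P * P') := by rw [h]; simp only [Matrix.mul_assoc]
      _ = A := by rw [hP, hP2, Matrix.one_mul, Matrix.mul_one]
  exact ⟨ι, i1, i2, d, S₁ * P', S₂ * Q', hc, hd, key hP h1, key hQ h2⟩

theorem quad_transport {R : Type*} [CommRing R] {ι κ : Type*} [Fintype ι] [Fintype κ]
    (A : Matrix ι ι R) (P : Matrix ι κ R) (x : κ → R) :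
    x ⬝ᵥ (Pᵀ * A * P) *ᵥ x = (P *ᵥ x) ⬝ᵥ A *ᵥ (P *ᵥ x) := by
  rw [Matrix.mul_assoc, ← mulVec_mulVec, ← mulVec_mulVec, dotProduct_mulVec, vecMul_transpose]

theorem loc_transport {m n : ℕ} {A B P P' Q Q' : Matrix (Fin m) (Fin m) ℚ} (hP : P * P' = 1)
    (hQ : Q * Q' = 1) (h : Loc n A B) : Loc n (Pᵀ * A * P) (Qᵀ * B * Q) := by
  intro p hp
  obtain ⟨T, hT, hq⟩ := h p
  have cast_mul : ∀ X Y : Matrix (Fin m) (Fin m) ℚ, (X * Y).map (Rat.cast : ℚ → ℚ_[p]) =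
      X.map (Rat.cast : ℚ → ℚ_[p]) * Y.map (Rat.cast : ℚ → ℚ_[p]) := fun X Y =>
    Matrix.map_mul (f := Rat.castHom ℚ_[p])
  have cast_inv : ∀ X Y : Matrix (Fin m) (Fin m) ℚ, X * Y = 1 →
      X.map (Rat.cast : ℚ → ℚ_[p]) * Y.map (Rat.cast : ℚ → ℚ_[p]) = 1 := by
    intro X Y h
    rw [← cast_mul, h]
    exact Matrix.map_one _ (by simp) (by simp)
  let eP := Matrix.toLin'OfInv (cast_inv _ _ (mul_eq_one_comm.1 hP)) (cast_inv _ _ hP)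
  let eQ := Matrix.toLin'OfInv (cast_inv _ _ (mul_eq_one_comm.1 hQ)) (cast_inv _ _ hQ)
  let e := LinearEquiv.prodCongr eP eQ
  have heP : ∀ x, eP x = P.map (Rat.cast : ℚ → ℚ_[p]) *ᵥ x := fun x => Matrix.toLin'_apply _ _
  have heQ : ∀ x, eQ x = Q.map (Rat.cast : ℚ → ℚ_[p]) *ᵥ x := fun x => Matrix.toLin'_apply _ _
  refine ⟨T.comap e.toLinearMap, ?_, ?_⟩
  · have : T.comap e.toLinearMap = T.map e.symm.toLinearMap := by
      rw [Submodule.map_equiv_eq_comap_symm, LinearEquiv.symm_symm]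
    rw [this, LinearEquiv.finrank_map_eq]
    exact hT
  · intro z hz
    have := hq _ hz
    change eP z.1 ⬝ᵥ _ *ᵥ eP z.1 = eQ z.2 ⬝ᵥ _ *ᵥ eQ z.2 at this
    rw [heP, heQ, ← quad_transport, ← quad_transport] at this
    rw [cast_mul, cast_mul, cast_mul, cast_mul]
    exact this

theorem diag_quad {K : Type*} [Field K] {ι : Type*} [Fintype ι] [DecidableEq ι] (f : ι → K) (x : ι → K) :
    x ⬝ᵥ diagonal f *ᵥ x = ∑ i, f i * x i ^ 2 := by
  simp only [dotProduct, mulVec_diagonal]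
  exact Finset.sum_congr rfl fun i _ => by ring

theorem diag_quad_cast {p : ℕ} [Fact p.Prime] {m : ℕ} (f : Fin m → ℚ) (x : Fin m → ℚ_[p]) :
    x ⬝ᵥ (diagonal f).map (Rat.cast : ℚ → ℚ_[p]) *ᵥ x = ∑ i, (f i : ℚ_[p]) * x i ^ 2 := by
  rw [diagonal_map (by simp), diag_quad]

theorem loc_peel {m n : ℕ} {a : ℚ} (ha : 0 < a) {f g : Fin m → ℚ}
    (h : Loc (n+1) (diagonal (Fin.cons a f : Fin (m+1) → ℚ)) (diagonal (Fin.cons a g : Fin (m+1) → ℚ))) :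
    Loc n (diagonal f) (diagonal g) := by
  intro p hp
  obtain ⟨T, hT, hq⟩ := h p
  have haK : (a : ℚ_[p]) ≠ 0 := by exact_mod_cast ha.ne'
  have hq' : ∀ z ∈ T, (a : ℚ_[p]) * z.1 0 ^ 2 + ∑ i, (f i : ℚ_[p]) * z.1 i.succ ^ 2 =
      (a : ℚ_[p]) * z.2 0 ^ 2 + ∑ i, (g i : ℚ_[p]) * z.2 i.succ ^ 2 := by
    intro z hz
    have := hq z hz
    rw [diag_quad_cast, diag_quad_cast, Fin.sum_univ_succ, Fin.sum_univ_succ] at this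
    simpa using this
  let p1 : ((Fin (m+1) → ℚ_[p]) × (Fin (m+1) → ℚ_[p])) →ₗ[ℚ_[p]] ℚ_[p] := (LinearMap.proj 0) ∘ₗ LinearMap.fst _ _ _
  let p2 : ((Fin (m+1) → ℚ_[p]) × (Fin (m+1) → ℚ_[p])) →ₗ[ℚ_[p]] ℚ_[p] := (LinearMap.proj 0) ∘ₗ LinearMap.snd _ _ _
  let φ : ((Fin (m+1) → ℚ_[p]) × (Fin (m+1) → ℚ_[p])) →ₗ[ℚ_[p]] ℚ_[p] := p1 - p2
  let tl : (Fin (m+1) → ℚ_[p]) →ₗ[ℚ_[p]] (Fin m → ℚ_[p]) := LinearMap.funLeft _ _ Fin.succ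
  let ψ : ((Fin (m+1) → ℚ_[p]) × (Fin (m+1) → ℚ_[p])) →ₗ[ℚ_[p]] (Fin m → ℚ_[p]) × (Fin m → ℚ_[p]) := LinearMap.prodMap tl tl
  have hφ : ∀ z, φ z = z.1 0 - z.2 0 := fun z => rfl
  have hψ : ∀ z, ψ z = (fun i => z.1 i.succ, fun i => z.2 i.succ) := fun z => rfl
  let T0 := T ⊓ LinearMap.ker φ
  have hT0 : ∀ z, z ∈ T0 ↔ z ∈ T ∧ z.1 0 = z.2 0 := by
    intro z
    rw [Submodule.mem_inf, LinearMap.mem_ker, hφ, sub_eq_zero]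
  have hrk := LinearMap.finrank_range_add_finrank_ker (ψ.domRestrict T0)
  rw [LinearMap.range_domRestrict] at hrk
  have hk : ∀ z ∈ T0, ψ z = 0 → z = z.1 0 • ((Pi.single 0 1, Pi.single 0 1) : ((Fin (m+1) → ℚ_[p]) × (Fin (m+1) → ℚ_[p]))) := by
    intro z hz h0
    rw [hψ] at h0
    have h1 := congrFun (congrArg Prod.fst h0)
    have h2 := congrFun (congrArg Prod.snd h0)
    have h3 := ((hT0 z).1 hz).2
    refine Prod.ext ?_ ?_
    · funext i
      refine Fin.cases ?_ (fun i => ?_) i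
      · simp
      · simpa using h1 i
    · funext i
      refine Fin.cases ?_ (fun i => ?_) i
      · simpa using h3.symm
      · simpa using h2 i
  refine ⟨T0.map ψ, ?_, ?_⟩
  · by_cases he : ((Pi.single 0 1, Pi.single 0 1) : ((Fin (m+1) → ℚ_[p]) × (Fin (m+1) → ℚ_[p]))) ∈ T
    · have hTT : T0 = T := by
        refine inf_eq_left.2 fun z hz => ?_
        have h1 := hq' z hz
        have h2 := hq' _ (T.add_mem hz he)
        simp only [Prod.fst_add, Prod.snd_add, Pi.add_apply, Pi.single_eq_same, ne_eq, Fin.succ_ne_zero,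
          not_false_eq_true, Pi.single_eq_of_ne, add_zero] at h2
        rw [LinearMap.mem_ker, hφ]
        have h3 : (a : ℚ_[p]) * 2 * (z.1 0 - z.2 0) = 0 := by linear_combination h2 - h1
        simpa [haK] using h3
      have hker : Module.finrank ℚ_[p] (LinearMap.ker (ψ.domRestrict T0)) ≤ 1 := by
        let j : LinearMap.ker (ψ.domRestrict T0) →ₗ[ℚ_[p]] ℚ_[p] :=
          p1 ∘ₗ T0.subtype ∘ₗ (LinearMap.ker (ψ.domRestrict T0)).subtype
        have hj : Function.Injective j := by
          rw [injective_iff_map_eq_zero]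
          intro z hz
          have h1 : ψ (z : T0) = 0 := z.2
          have h2 := hk _ (z : T0).2 h1
          have h3 : ((z : T0) : ((Fin (m+1) → ℚ_[p]) × (Fin (m+1) → ℚ_[p]))).1 0 = 0 := hz
          rw [h3, zero_smul] at h2
          exact Subtype.ext (Subtype.ext h2)
        have := LinearMap.finrank_le_finrank_of_injective hj
        rwa [Module.finrank_self] at this
      rw [hTT] at hrk hker ⊢
      omega
    · have hker : LinearMap.ker (ψ.domRestrict T0) = ⊥ := by
        rw [LinearMap.ker_eq_bot']
        intro z hz
        have h2 := hk _ z.2 hz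
        by_cases h0 : (z : ((Fin (m+1) → ℚ_[p]) × (Fin (m+1) → ℚ_[p]))).1 0 = 0
        · rw [h0, zero_smul] at h2
          exact Subtype.ext h2
        · exfalso
          apply he
          have h3 := T.smul_mem ((z : ((Fin (m+1) → ℚ_[p]) × (Fin (m+1) → ℚ_[p]))).1 0)⁻¹ ((hT0 z).1 z.2).1
          rw [h2, smul_smul] at h3
          simpa [h0] using h3
      rw [hker, finrank_bot] at hrk
      have h1 := Submodule.finrank_sup_add_finrank_inf_eq T (LinearMap.ker φ)
      have h2 := Submodule.finrank_le (T ⊔ LinearMap.ker φ)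
      have h3 := LinearMap.finrank_range_add_finrank_ker φ
      have h4 : Module.finrank ℚ_[p] (LinearMap.range φ) ≤ 1 := by
        have := Submodule.finrank_le (LinearMap.range φ)
        rwa [Module.finrank_self] at this
      change Module.finrank ℚ_[p] _ + Module.finrank ℚ_[p] T0 = _ at h1
      omega
  · rintro _ ⟨z, hz, rfl⟩
    obtain ⟨hz1, hz2⟩ := (hT0 z).1 hz
    rw [diag_quad_cast, diag_quad_cast, hψ]
    have := hq' z hz1
    rw [hz2] at this
    exact add_left_cancel this

theorem glob_peel {m n : ℕ} {a : ℚ} (ha : 0 < a) {f g : Fin m → ℚ}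
    (h : Glob n (diagonal f) (diagonal g)) :
    Glob (n+1) (diagonal (Fin.cons a f : Fin (m+1) → ℚ)) (diagonal (Fin.cons a g : Fin (m+1) → ℚ)) := by
  obtain ⟨ι, i1, i2, d, S₁, S₂, hc, hd, h1, h2⟩ := h
  let E : Matrix ι (Fin m) ℚ → Matrix (Option ι) (Fin (m+1)) ℚ := fun S => Matrix.of fun i =>
    Option.elim i (Pi.single 0 1) (fun i => Fin.cons 0 (S i))
  have key : ∀ (f : Fin m → ℚ) (S : Matrix ι (Fin m) ℚ), Sᵀ * diagonal d * S = diagonal f →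
      (E S)ᵀ * diagonal (fun i : Option ι => Option.elim i a d) * E S = diagonal (Fin.cons a f : Fin (m+1) → ℚ) := by
    intro f S h
    ext i j
    have hh := fun i j => congrFun (congrFun h i) j
    simp_rw [Matrix.mul_apply (N := S), mul_diagonal, transpose_apply] at hh
    rw [Matrix.mul_apply, Fintype.sum_option]
    simp only [mul_diagonal, transpose_apply]
    refine Fin.cases ?_ (fun i => ?_) i <;> refine Fin.cases ?_ (fun j => ?_) j
    · simp [E]
    · rw [diagonal_apply_ne _ (Fin.succ_ne_zero _).symm]
      simp [E]
    · rw [diagonal_apply_ne _ (Fin.succ_ne_zero _)]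
      simp [E]
    · simp only [E, of_apply, Option.elim, Fin.cons_succ]
      rw [hh]
      simp [diagonal_apply]
  refine ⟨Option ι, inferInstance, inferInstance, fun i => Option.elim i a d, E S₁, E S₂, ?_, ?_, key f S₁ h1, key g S₂ h2⟩
  · simp [hc]
  · intro i
    cases i
    · exact ha
    · exact hd _

theorem glob_base {m n : ℕ} (hn : 2 * m ≤ n) {f g : Fin m → ℚ} (hf : ∀ i, 0 < f i)
    (hg : ∀ i, 0 < g i) : Glob n (diagonal f) (diagonal g) := by
  refine ⟨Fin m ⊕ Fin m ⊕ Fin (n - 2 * m), inferInstance, inferInstance,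
    Sum.elim f (Sum.elim g 1), Matrix.of fun i j => Sum.elim (fun i => if i = j then 1 else 0) (fun _ => 0) i,
    Matrix.of fun i j => Sum.elim (fun _ => 0) (Sum.elim (fun i => if i = j then 1 else 0) (fun _ => 0)) i,
    ?_, ?_, ?_, ?_⟩
  · simp; omega
  · rintro (i | i | i)
    · exact hf i
    · exact hg i
    · simp
  · ext i j
    rw [Matrix.mul_apply]
    simp [mul_diagonal, diagonal_apply, Fintype.sum_sum_type]
    by_cases h : i = j <;> simp [h, eq_comm]
  · ext i j
    rw [Matrix.mul_apply]
    simp [mul_diagonal, diagonal_apply, Fintype.sum_sum_type]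
    by_cases h : i = j <;> simp [h, eq_comm]

theorem W_diag (m : ℕ) : ∀ (n : ℕ) (f g : Fin m → ℚ), m ≤ n → (∀ i, 0 < f i) → (∀ i, 0 < g i) →
    Loc n (diagonal f) (diagonal g) → Glob n (diagonal f) (diagonal g) := by
  induction m with
  | zero => intro n f g hn hf hg h; exact glob_base (by omega) hf hg
  | succ m IH =>
    intro n f g hmn hf hg h
    by_cases h2 : 2 * (m + 1) ≤ n
    · exact glob_base h2 hf hg
    obtain ⟨v, w, hv, hw, he⟩ := hm_rat hf hg (fun p hp => by
      obtain ⟨T, hT, hq⟩ := h p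
      have hpos : T ≠ ⊥ := by
        rintro rfl
        rw [finrank_bot] at hT
        omega
      obtain ⟨z, hz, hz0⟩ := Submodule.exists_mem_ne_zero_of_ne_bot hpos
      have := hq z hz
      rw [diag_quad_cast, diag_quad_cast] at this
      refine ⟨z.1, z.2, ?_, this⟩
      by_contra hc
      push Not at hc
      exact hz0 (Prod.ext hc.1 hc.2))
    obtain ⟨P, P', f', hP, hf', hPf⟩ := split (pd_diag hf) hv
    obtain ⟨Q, Q', g', hQ, hg', hQg⟩ := split (pd_diag hg) hw
    have ha := (pd_diag hf).2 v hv
    have hab : v ⬝ᵥ diagonal f *ᵥ v = w ⬝ᵥ diagonal g *ᵥ w := by rw [diag_quad, diag_quad, he]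
    obtain ⟨n, rfl⟩ : ∃ k, n = k + 1 := ⟨n - 1, by omega⟩
    have h1 := loc_transport hP hQ h
    rw [hPf, hQg, ← hab] at h1
    apply glob_transport hP hQ
    rw [hPf, hQg, ← hab]
    exact glob_peel ha (IH n f' g' (by omega) hf' hg' (loc_peel ha h1))

theorem W {m n : ℕ} (hmn : m ≤ n) {A B : Matrix (Fin m) (Fin m) ℚ} (hA : PD A) (hB : PD B)
    (h : Loc n A B) : Glob n A B := by
  rcases m with _ | m
  · have hA0 : A = diagonal (fun i => i.elim0) := by ext i; exact i.elim0
    have hB0 : B = diagonal (fun i => i.elim0) := by ext i; exact i.elim0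
    rw [hA0, hB0]
    exact glob_base (by omega) (fun i => i.elim0) (fun i => i.elim0)
  · have hv : (1 : Fin (m+1) → ℚ) ≠ 0 := one_ne_zero
    obtain ⟨P, P', f', hP, hf', hPf⟩ := split hA hv
    obtain ⟨Q, Q', g', hQ, hg', hQg⟩ := split hB hv
    have h1 := loc_transport hP hQ h
    apply glob_transport hP hQ
    rw [hPf, hQg] at h1 ⊢
    refine W_diag _ _ _ _ hmn ?_ ?_ h1
    · intro i
      refine Fin.cases ?_ (fun i => ?_) i
      · exact hA.2 _ hv
      · exact hf' i
    · intro i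
      refine Fin.cases ?_ (fun i => ?_) i
      · exact hB.2 _ hv
      · exact hg' i
end Bur

namespace Bur
section lat
set_option linter.unusedSectionVars false
variable {V : Type*} [AddCommGroup V] [Module ℚ V]

/-- integrality of a rational number -/
def IsZ (r : ℚ) : Prop := ∃ k : ℤ, r = k

theorem IsZ.add {r s : ℚ} (h : IsZ r) (h' : IsZ s) : IsZ (r + s) := by
  obtain ⟨a, rfl⟩ := h; obtain ⟨b, rfl⟩ := h'; exact ⟨a + b, by push_cast; rfl⟩
theorem IsZ.mul {r s : ℚ} (h : IsZ r) (h' : IsZ s) : IsZ (r * s) := by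
  obtain ⟨a, rfl⟩ := h; obtain ⟨b, rfl⟩ := h'; exact ⟨a * b, by push_cast; rfl⟩
theorem IsZ.sub {r s : ℚ} (h : IsZ r) (h' : IsZ s) : IsZ (r - s) := by
  obtain ⟨a, rfl⟩ := h; obtain ⟨b, rfl⟩ := h'; exact ⟨a - b, by push_cast; rfl⟩
theorem isZ_int (k : ℤ) : IsZ k := ⟨k, rfl⟩

theorem zsmul_rat (k : ℤ) (v : V) : k • v = (k : ℚ) • v := (Int.cast_smul_eq_zsmul ℚ k v).symm

/-- full lattices -/
def IsLat (L : Submodule ℤ V) : Prop := L.FG ∧ ∀ v : V, ∃ k : ℤ, k ≠ 0 ∧ k • v ∈ L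

/-- even lattices -/
def EvenL (b : LinearMap.BilinForm ℚ V) (L : Submodule ℤ V) : Prop := ∀ x ∈ L, ∃ k : ℤ, b x x = 2 * k

/-- elements pairing integrally with w -/
def cut (b : LinearMap.BilinForm ℚ V) (M : Submodule ℤ V) (w : V) : Submodule ℤ V where
  carrier := {z | z ∈ M ∧ IsZ (b z w)}
  add_mem' := by
    rintro x y ⟨hx, hx'⟩ ⟨hy, hy'⟩
    refine ⟨M.add_mem hx hy, ?_⟩
    rw [map_add, LinearMap.add_apply]
    exact hx'.add hy'
  zero_mem' := ⟨M.zero_mem, 0, by simp⟩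
  smul_mem' := by
    rintro c x ⟨hx, hx'⟩
    refine ⟨M.smul_mem _ hx, ?_⟩
    rw [zsmul_rat, map_smul, LinearMap.smul_apply, smul_eq_mul]
    exact (isZ_int c).mul hx'

theorem mem_cut {b : LinearMap.BilinForm ℚ V} {M : Submodule ℤ V} {w z : V} :
    z ∈ cut b M w ↔ z ∈ M ∧ IsZ (b z w) := Iff.rfl

/-- neighbour lattice -/
def nb (b : LinearMap.BilinForm ℚ V) (M : Submodule ℤ V) (w : V) : Submodule ℤ V :=
  cut b M w ⊔ Submodule.span ℤ {w}

/-- same genus, rational version -/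
def GenEq (b : LinearMap.BilinForm ℚ V) (M N : Submodule ℤ V) : Prop :=
  ∀ p : ℕ, p.Prime → ∃ g : V ≃ₗ[ℚ] V, (∀ x y, b (g x) (g y) = b x y) ∧
    (∀ z ∈ M, ∃ s : ℤ, ¬ (p : ℤ) ∣ s ∧ s • g z ∈ N) ∧
    (∀ z ∈ N, ∃ s : ℤ, ¬ (p : ℤ) ∣ s ∧ s • g.symm z ∈ M)

theorem GenEq.refl (b : LinearMap.BilinForm ℚ V) (M : Submodule ℤ V) : GenEq b M M := by
  intro p hp
  have h1 : ¬ (p : ℤ) ∣ 1 := by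
    intro h
    exact hp.one_lt.ne' (by exact_mod_cast Int.eq_one_of_dvd_one (by positivity) h)
  exact ⟨LinearEquiv.refl ℚ V, fun _ _ => rfl, fun z hz => ⟨1, h1, by simpa using hz⟩,
    fun z hz => ⟨1, h1, by simpa using hz⟩⟩

theorem GenEq.symm {b : LinearMap.BilinForm ℚ V} {M N : Submodule ℤ V} (h : GenEq b M N) :
    GenEq b N M := by
  intro p hp
  obtain ⟨g, hg, h1, h2⟩ := h p hp
  refine ⟨g.symm, fun x y => ?_, h2, h1⟩
  rw [← hg, g.apply_symm_apply, g.apply_symm_apply]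

theorem GenEq.trans {b : LinearMap.BilinForm ℚ V} {M N L : Submodule ℤ V} (h : GenEq b M N)
    (h' : GenEq b N L) : GenEq b M L := by
  intro p hp
  obtain ⟨g, hg, h1, h2⟩ := h p hp
  obtain ⟨g', hg', h1', h2'⟩ := h' p hp
  have hpi := Nat.prime_iff_prime_int.1 hp
  refine ⟨g.trans g', fun x y => ?_, fun z hz => ?_, fun z hz => ?_⟩
  · rw [LinearEquiv.trans_apply, LinearEquiv.trans_apply, hg', hg]
  · obtain ⟨s, hs, hz⟩ := h1 z hz
    obtain ⟨s', hs', hz⟩ := h1' _ hz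
    refine ⟨s' * s, fun h => (hpi.dvd_or_dvd h).elim hs' hs, ?_⟩
    rw [map_zsmul] at hz
    rwa [mul_smul]
  · obtain ⟨s, hs, hz⟩ := h2' z hz
    obtain ⟨s', hs', hz⟩ := h2 _ hz
    refine ⟨s' * s, fun h => (hpi.dvd_or_dvd h).elim hs' hs, ?_⟩
    rw [map_zsmul] at hz
    rwa [mul_smul]

theorem EvenL.isZ {b : LinearMap.BilinForm ℚ V} (hb : ∀ x y, b x y = b y x) {L : Submodule ℤ V}
    (h : EvenL b L) {x y : V} (hx : x ∈ L) (hy : y ∈ L) : IsZ (b x y) := by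
  obtain ⟨k1, h1⟩ := h x hx
  obtain ⟨k2, h2⟩ := h y hy
  obtain ⟨k3, h3⟩ := h _ (L.add_mem hx hy)
  simp only [map_add, LinearMap.add_apply] at h3
  rw [hb y x] at h3
  exact ⟨k3 - k1 - k2, by push_cast; linarith⟩

theorem IsLat.mono {L M : Submodule ℤ V} (h : IsLat L) (hLM : L ≤ M) (hM : M.FG) : IsLat M :=
  ⟨hM, fun v => by obtain ⟨k, hk, h⟩ := h.2 v; exact ⟨k, hk, hLM h⟩⟩

theorem IsLat.cut {b : LinearMap.BilinForm ℚ V} {M : Submodule ℤ V} (h : IsLat M) (w : V) :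
    IsLat (cut b M w) := by
  refine ⟨?_, fun v => ?_⟩
  · have : IsNoetherian ℤ M := isNoetherian_of_fg_of_noetherian M h.1
    exact (isNoetherian_submodule.1 this) _ (fun z hz => hz.1)
  · obtain ⟨k, hk, hv⟩ := h.2 v
    refine ⟨(b (k • v) w).den * k, mul_ne_zero (by exact_mod_cast (b (k • v) w).den_ne_zero) hk, ?_⟩
    rw [mul_smul]
    refine ⟨M.smul_mem _ hv, (b (k • v) w).num, ?_⟩
    rw [zsmul_rat (_ : ℤ) (k • v), map_smul, LinearMap.smul_apply, smul_eq_mul]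
    push_cast
    rw [mul_comm]
    exact Rat.mul_den_eq_num _

theorem IsLat.nb {b : LinearMap.BilinForm ℚ V} {M : Submodule ℤ V} (h : IsLat M) (w : V) :
    IsLat (nb b M w) :=
  (h.cut (b := b) w).mono le_sup_left ((h.cut w).1.sup (Submodule.fg_span_singleton w))

theorem EvenL.sup {b : LinearMap.BilinForm ℚ V} (hb : ∀ x y, b x y = b y x) {L : Submodule ℤ V}
    (h : EvenL b L) {w : V} (hw : ∃ k : ℤ, b w w = 2 * k) (hz : ∀ z ∈ L, IsZ (b z w)) :
    EvenL b (L ⊔ Submodule.span ℤ {w}) := by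
  intro x hx
  obtain ⟨z, hzL, u, hu, rfl⟩ := Submodule.mem_sup.1 hx
  obtain ⟨a, rfl⟩ := Submodule.mem_span_singleton.1 hu
  obtain ⟨k1, h1⟩ := hw
  obtain ⟨k2, h2⟩ := h z hzL
  obtain ⟨k3, h3⟩ := hz z hzL
  rw [zsmul_rat]
  simp only [map_add, LinearMap.add_apply, map_smul, LinearMap.smul_apply, smul_eq_mul, hb w z, h1, h2, h3]
  exact ⟨k2 + a * k3 + a * a * k1, by push_cast; ring⟩

theorem EvenL.nb {b : LinearMap.BilinForm ℚ V} (hb : ∀ x y, b x y = b y x) {M : Submodule ℤ V}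
    (h : EvenL b M) {w : V} (hw : ∃ k : ℤ, b w w = 2 * k) : EvenL b (nb b M w) :=
  EvenL.sup hb (L := cut b M w) (fun x hx => h x hx.1) hw (fun _ hz => hz.2)

theorem nb_genEq {b : LinearMap.BilinForm ℚ V} (hb : ∀ x y, b x y = b y x) {M : Submodule ℤ V}
    (hM : EvenL b M) {w y : V} (hw : ∃ k : ℤ, b w w = 2 * k) {p : ℕ} (hp : p.Prime)
    (hpw : (p : ℤ) • w ∈ M) (hy : y ∈ M) {k : ℤ} (hk : (p : ℚ) * b w y = k) (hpk : ¬ (p : ℤ) ∣ k) :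
    GenEq b M (nb b M w) := by
  have hpZ : ∀ z ∈ M, IsZ (p * b z w) := by
    intro z hz
    have := hM.isZ hb hz hpw
    rw [zsmul_rat, map_smul, smul_eq_mul] at this
    simpa using this
  intro l hl
  by_cases hlp : l = p
  · subst hlp
    obtain ⟨k0, hk0⟩ := hw
    obtain ⟨k1, hk1⟩ := hM y hy
    set t : ℤ := k0 + k1 with ht
    set s : ℤ := l * t - k with hs
    set v : V := w - y with hv
    have hls : ¬ (l : ℤ) ∣ s := fun h => hpk ((dvd_sub_right (Dvd.intro _ rfl)).1 h)
    have hs0 : (s : ℚ) ≠ 0 := by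
      intro h
      apply hls
      have : s = 0 := by exact_mod_cast h
      rw [this]; exact dvd_zero _
    have hvv : (l : ℚ) * b v v = 2 * s := by
      simp only [hv, map_sub, LinearMap.sub_apply, hk0, hk1, hb y w, hs, ht]
      push_cast
      linear_combination (-2) * hk
    have hvv0 : b v v ≠ 0 := by
      intro h
      rw [h, mul_zero] at hvv
      exact hs0 (by linarith)
    let φ : Module.Dual ℚ V := (2 / b v v) • b v
    have hφ : φ v = 2 := by
      simp only [φ, LinearMap.smul_apply, smul_eq_mul]
      field_simp
    let g := Module.reflection hφ
    have hg : ∀ z, g z = z - (2 / b v v * b v z) • v := fun z => Module.reflection_apply z hφ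
    have hsg : ∀ z, s • g z = (s : ℚ) • z - ((l : ℚ) * b z v) • v := by
      intro z
      rw [zsmul_rat, hg, smul_sub, smul_smul, hb v z]
      congr 2
      field_simp
      linear_combination - b z v * hvv
    have hgs : g.symm = g := Module.reflection_symm hφ
    refine ⟨g, ?_, ?_, ?_⟩
    · intro x y
      rw [hg, hg]
      simp only [map_sub, LinearMap.sub_apply, map_smul, LinearMap.smul_apply, smul_eq_mul, hb x v]
      field_simp
      ring
    · intro z hz
      refine ⟨s, hls, ?_⟩
      obtain ⟨c1, hc1⟩ := hpZ z hz
      obtain ⟨c2, hc2⟩ := hM.isZ hb hz hy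
      have hc : (l : ℚ) * b z v = ((c1 - l * c2 : ℤ) : ℚ) := by
        simp only [hv, map_sub, hc2]
        push_cast
        linear_combination hc1
      rw [hsg, hc]
      set c := c1 - l * c2 with hcdef
      have : (s : ℚ) • z - (c : ℚ) • v = (s • z + c • y) + (-c) • w := by
        rw [zsmul_rat, zsmul_rat, zsmul_rat, hv]
        push_cast
        module
      rw [this]
      refine Submodule.add_mem_sup ?_ (Submodule.smul_mem _ _ (Submodule.mem_span_singleton_self w))
      refine ⟨M.add_mem (M.smul_mem _ hz) (M.smul_mem _ hy), t * c1 - k * c2, ?_⟩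
      rw [zsmul_rat, zsmul_rat]
      simp only [map_add, LinearMap.add_apply, map_smul, LinearMap.smul_apply, smul_eq_mul, hb y w]
      have hl0 : (l : ℚ) ≠ 0 := by exact_mod_cast hl.ne_zero
      apply mul_left_cancel₀ hl0
      rw [hs, hcdef]
      push_cast
      linear_combination (l * t - k : ℚ) * hc1 + (c1 - l * c2 : ℚ) * hk
    · intro z hz
      refine ⟨s, hls, ?_⟩
      rw [hgs]
      have hle : nb b M w ≤ M.comap ((s • (g : V →ₗ[ℚ] V)).restrictScalars ℤ) := by
        refine sup_le ?_ ?_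
        · intro z hz
          obtain ⟨hz, c1, hc1⟩ := hz
          obtain ⟨c2, hc2⟩ := hM.isZ hb hz hy
          change s • g z ∈ M
          rw [hsg]
          have : (s : ℚ) • z - ((l : ℚ) * b z v) • v = s • z - (c1 - c2) • ((l : ℤ) • w) + ((c1 - c2) * l) • y := by
            simp only [zsmul_rat, hv, map_sub, hc1, hc2]
            push_cast
            module
          rw [this]
          exact M.add_mem (M.sub_mem (M.smul_mem _ hz) (M.smul_mem _ hpw)) (M.smul_mem _ hy)
        · rw [Submodule.span_singleton_le_iff_mem]
          change s • g w ∈ M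
          rw [hsg]
          have h1 : (l : ℚ) * b w v = 2 * l * k0 - k := by
            simp only [hv, map_sub, hk0]
            linear_combination - hk
          have : (s : ℚ) • w - ((l : ℚ) * b w v) • v = (t - 2 * k0) • ((l : ℤ) • w) + (2 * l * k0 - k) • y := by
            rw [h1, hs, hv]
            simp only [zsmul_rat]
            push_cast
            module
          rw [this]
          exact M.add_mem (M.smul_mem _ hpw) (M.smul_mem _ hy)
      exact hle hz
  · have hd : ¬ (l : ℤ) ∣ (p : ℤ) := by
      intro h
      exact hlp ((Nat.prime_dvd_prime_iff_eq hl hp).1 (by exact_mod_cast h))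
    refine ⟨LinearEquiv.refl ℚ V, fun _ _ => rfl, fun z hz => ⟨p, hd, ?_⟩, fun z hz => ⟨p, hd, ?_⟩⟩
    · refine Submodule.mem_sup_left ⟨M.smul_mem _ hz, ?_⟩
      rw [zsmul_rat, map_smul, LinearMap.smul_apply, smul_eq_mul]
      exact_mod_cast hpZ z hz
    · obtain ⟨z, hzL, u, hu, rfl⟩ := Submodule.mem_sup.1 hz
      obtain ⟨a, rfl⟩ := Submodule.mem_span_singleton.1 hu
      change (p : ℤ) • (z + a • w) ∈ M
      rw [smul_add, smul_comm]
      exact M.add_mem (M.smul_mem _ hzL.1) (M.smul_mem _ hpw)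

theorem exists_prime_mult {L : Submodule ℤ V} (hL : IsLat L) {x : V} (hx : x ∉ L) :
    ∃ (a : ℤ) (p : ℕ), p.Prime ∧ a • x ∉ L ∧ (p : ℤ) • (a • x) ∈ L := by
  classical
  have hex : ∃ k : ℕ, 0 < k ∧ (k : ℤ) • x ∈ L := by
    obtain ⟨k, hk, h⟩ := hL.2 x
    refine ⟨k.natAbs, Int.natAbs_pos.2 hk, ?_⟩
    rcases Int.natAbs_eq k with h' | h'
    · rwa [← h']
    · have h2 : ((k.natAbs : ℕ) : ℤ) = -k := by omega
      rw [h2, neg_smul]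
      exact L.neg_mem h
  set k := Nat.find hex with hk
  obtain ⟨hk0, hkL⟩ := Nat.find_spec hex
  rw [← hk] at hk0 hkL
  have hk1 : k ≠ 1 := by
    intro h
    rw [h] at hkL
    exact hx (by simpa using hkL)
  have hp := Nat.minFac_prime hk1
  obtain ⟨c, hc⟩ := Nat.minFac_dvd k
  refine ⟨c, k.minFac, hp, ?_, ?_⟩
  · intro h
    have hc0 : 0 < c := by
      rcases Nat.eq_zero_or_pos c with h | h
      · rw [h, mul_zero] at hc; omega
      · exact h
    have : k ≤ c := Nat.find_min' hex ⟨hc0, h⟩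
    have h2 := hp.two_le
    have : k ≥ 2 * c := by
      calc k = k.minFac * c := hc
        _ ≥ 2 * c := Nat.mul_le_mul_right _ h2
    omega
  · rw [← mul_smul]
    have : ((k.minFac : ℤ) * (c : ℤ)) = (k : ℤ) := by exact_mod_cast hc.symm
    rw [this]
    exact hkL

theorem same_genus_over {b : LinearMap.BilinForm ℚ V} (hb : ∀ x y, b x y = b y x)
    {L₂ : Submodule ℤ V} (hL₂ : IsLat L₂) (he₂ : EvenL b L₂) :
    ∀ L₁ : Submodule ℤ V, IsLat L₁ → EvenL b L₁ → ∃ M₁ M₂ : Submodule ℤ V, L₁ ≤ M₁ ∧ L₂ ≤ M₂ ∧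
      IsLat M₁ ∧ IsLat M₂ ∧ EvenL b M₁ ∧ EvenL b M₂ ∧ GenEq b M₁ M₂ := by
  have : IsNoetherian ℤ L₂ := isNoetherian_of_fg_of_noetherian L₂ hL₂.1
  suffices H : ∀ (T : Submodule ℤ L₂) (L₁ : Submodule ℤ V), L₁.comap L₂.subtype = T → IsLat L₁ → EvenL b L₁ →
      ∃ M₁ M₂ : Submodule ℤ V, L₁ ≤ M₁ ∧ L₂ ≤ M₂ ∧
      IsLat M₁ ∧ IsLat M₂ ∧ EvenL b M₁ ∧ EvenL b M₂ ∧ GenEq b M₁ M₂ from fun L₁ => H _ L₁ rfl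
  intro T
  induction T using WellFoundedGT.induction with
  | ind T IH =>
  intro L₁ hT hL₁ he₁
  by_cases hle : L₂ ≤ L₁
  · exact ⟨L₁, L₁, le_rfl, hle, hL₁, hL₁, he₁, he₁, GenEq.refl b L₁⟩
  obtain ⟨x0, hx02, hx01⟩ := Set.not_subset.1 hle
  obtain ⟨a, p, hp, hx1, hpx⟩ := exists_prime_mult hL₁ hx01
  have hx2 : a • x0 ∈ L₂ := L₂.smul_mem _ hx02
  generalize a • x0 = x at hx1 hpx hx2
  have grow : ∀ L' : Submodule ℤ V, (∀ z ∈ L₁, z ∈ L₂ → z ∈ L') → x ∈ L' → T < L'.comap L₂.subtype := by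
    intro L' h1 h2
    rw [← hT]
    refine lt_of_le_of_ne (fun z hz => h1 _ hz z.2) ?_
    intro h
    have : (⟨x, hx2⟩ : L₂) ∈ L'.comap L₂.subtype := h2
    rw [← h] at this
    exact hx1 this
  by_cases hzint : ∀ z ∈ L₁, IsZ (b z x)
  · have hlat : IsLat (L₁ ⊔ Submodule.span ℤ {x}) :=
      hL₁.mono le_sup_left (hL₁.1.sup (Submodule.fg_span_singleton x))
    obtain ⟨M₁, M₂, h1, h2⟩ := IH _ (grow (L₁ ⊔ Submodule.span ℤ {x})
      (fun z hz _ => Submodule.mem_sup_left hz)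
      (Submodule.mem_sup_right (Submodule.mem_span_singleton_self x))) _ rfl hlat
      (EvenL.sup hb he₁ (he₂ x hx2) hzint)
    exact ⟨M₁, M₂, le_sup_left.trans h1, h2⟩
  · push Not at hzint
    obtain ⟨w, hw, hwx⟩ := hzint
    have hxnb : x ∈ nb b L₁ x := Submodule.mem_sup_right (Submodule.mem_span_singleton_self x)
    obtain ⟨M, M₂, h1, h2, hM, hM₂, heM, heM₂, hgen⟩ := IH _ (grow (nb b L₁ x)
      (fun z hz hz2 => Submodule.mem_sup_left ⟨hz, he₂.isZ hb hz2 hx2⟩) hxnb) _ rfl (hL₁.nb x)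
      (he₁.nb hb (he₂ x hx2))
    have hpZ : ∀ z ∈ L₁, IsZ (p * b z x) := by
      intro z hz
      have := he₁.isZ hb hz hpx
      rw [zsmul_rat, map_smul, smul_eq_mul] at this
      simpa using this
    have hp0 : (p : ℚ) ≠ 0 := by exact_mod_cast hp.ne_zero
    obtain ⟨k, hk⟩ := hpZ w hw
    have hpk : ¬ (p : ℤ) ∣ k := by
      rintro ⟨j, rfl⟩
      apply hwx
      refine ⟨j, mul_left_cancel₀ hp0 ?_⟩
      rw [hk]; push_cast; rfl
    have hpw : (p : ℤ) • w ∈ M := by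
      refine h1 (Submodule.mem_sup_left ⟨L₁.smul_mem _ hw, k, ?_⟩)
      rw [zsmul_rat, map_smul, LinearMap.smul_apply, smul_eq_mul]
      exact_mod_cast hk
    refine ⟨nb b M w, M₂, ?_, h2, hM.nb w, hM₂, heM.nb hb (he₁ w hw), heM₂,
      (nb_genEq hb heM (he₁ w hw) hp hpw (h1 hxnb) hk hpk).symm.trans hgen⟩
    intro z hz
    obtain ⟨j, hj⟩ := hpZ z hz
    obtain ⟨u, u', huu⟩ : IsCoprime k (p : ℤ) :=
      ((Nat.prime_iff_prime_int.1 hp).coprime_iff_not_dvd.2 hpk).symm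
    have hz' : z = (z - (j * u) • w) + (j * u) • w := by abel
    rw [hz']
    refine Submodule.add_mem_sup ⟨h1 (Submodule.mem_sup_left ⟨L₁.sub_mem hz (L₁.smul_mem _ hw), j * u', ?_⟩), ?_⟩
      (Submodule.smul_mem _ _ (Submodule.mem_span_singleton_self w))
    · rw [zsmul_rat]
      simp only [map_sub, LinearMap.sub_apply, map_smul, LinearMap.smul_apply, smul_eq_mul]
      apply mul_left_cancel₀ hp0
      have huu' : (u : ℚ) * k + u' * p = 1 := by exact_mod_cast huu
      push_cast
      linear_combination hj - j * u * hk - j * huu'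
    · exact he₁.isZ hb (L₁.sub_mem hz (L₁.smul_mem _ hw)) hw
end lat
end Bur

namespace Bur
open Matrix
section lat
variable {V : Type*} [AddCommGroup V] [Module ℚ V]

theorem exists_adapted_basis {n : ℕ} (hn : Module.finrank ℚ V = n) {M : Submodule ℤ V} (hM : IsLat M) :
    ∃ β : Module.Basis (Fin n) ℚ V, ∀ x, x ∈ M ↔ ∀ i, IsZ (β.repr x i) := by
  have : Module.Finite ℤ M := Module.Finite.iff_fg.2 hM.1
  have : Module.IsTorsionFree ℤ V := Module.IsTorsionFree.trans_faithfulSMul ℤ ℚ V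
  have : Module.Free ℤ M := inferInstance
  let bM := Module.finBasis ℤ M
  let v : Fin (Module.finrank ℤ M) → V := fun i => (bM i : V)
  have hv : LinearIndependent ℤ v :=
    bM.linearIndependent.map' M.subtype (Submodule.ker_subtype M)
  have hvQ : LinearIndependent ℚ v := (LinearIndependent.iff_fractionRing ℤ ℚ).1 hv
  have hspan : Submodule.span ℤ (Set.range v) = M := by
    have h1 : Set.range v = M.subtype '' Set.range bM := by
      rw [← Set.range_comp]; rfl
    rw [h1, Submodule.span_image, bM.span_eq, Submodule.map_top, Submodule.range_subtype]
  have hsp : ⊤ ≤ Submodule.span ℚ (Set.range v) := by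
    intro x _
    obtain ⟨k, hk, hx⟩ := hM.2 x
    rw [← hspan] at hx
    have h2 := Submodule.span_le_restrictScalars ℤ ℚ (Set.range v) hx
    rw [Submodule.restrictScalars_mem, zsmul_rat] at h2
    have h3 := Submodule.smul_mem _ (k : ℚ)⁻¹ h2
    rwa [smul_smul, inv_mul_cancel₀ (by exact_mod_cast hk), one_smul] at h3
  let β := Module.Basis.mk hvQ hsp
  have hr : Module.finrank ℤ M = n := by
    rw [← hn, Module.finrank_eq_card_basis β, Fintype.card_fin]
  have hβ : ∀ x, x ∈ M ↔ ∀ i, IsZ (β.repr x i) := by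
    intro x
    have h1 : Set.range β = Set.range v := by rw [Module.Basis.coe_mk]
    conv_lhs => rw [← hspan, ← h1]
    rw [Module.Basis.mem_span_iff_repr_mem]
    refine forall_congr' fun i => ?_
    simp only [Set.mem_range, eq_intCast, IsZ]
    exact exists_congr fun k => eq_comm
  refine ⟨β.reindex (finCongr hr), fun x => ?_⟩
  rw [hβ]
  constructor
  · intro h i
    rw [Module.Basis.repr_reindex_apply]
    exact h _
  · intro h i
    have := h (finCongr hr i)
    rwa [Module.Basis.repr_reindex_apply, Equiv.symm_apply_apply] at this

theorem gram_eq (b : LinearMap.BilinForm ℚ V) {n : ℕ} {κ : Type*} (β : Module.Basis (Fin n) ℚ V)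
    (u : κ → V) :
    (β.toMatrix u)ᵀ * (Matrix.of fun i j => b (β i) (β j)) * β.toMatrix u =
      Matrix.of fun i j => b (u i) (u j) := by
  ext i j
  rw [of_apply]
  conv_rhs => rw [← β.sum_toMatrix_smul_self u i, ← β.sum_toMatrix_smul_self u j]
  simp only [Matrix.mul_apply, transpose_apply, of_apply, map_sum, LinearMap.sum_apply, map_smul,
    LinearMap.smul_apply, smul_eq_mul, Finset.mul_sum, Finset.sum_mul]
  refine Finset.sum_congr rfl fun k _ => Finset.sum_congr rfl fun l _ => by ring

theorem padic_integral {p : ℕ} [hp : Fact p.Prime] {r : ℚ} {s : ℤ} (hs : ¬ (p : ℤ) ∣ s)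
    (h : IsZ (s * r)) : ‖(r : ℚ_[p])‖ ≤ 1 := by
  obtain ⟨k, hk⟩ := h
  have h1 : ‖(s : ℚ_[p])‖ = 1 := by
    refine le_antisymm (Padic.norm_int_le_one s) ?_
    by_contra hlt
    push Not at hlt
    exact hs ((Padic.norm_intCast_lt_one_iff (p := p)).1 hlt)
  have h2 : (s : ℚ_[p]) * r = k := by exact_mod_cast congrArg (Rat.cast : ℚ → ℚ_[p]) hk
  have h3 : ‖(s : ℚ_[p]) * r‖ ≤ 1 := by rw [h2]; exact Padic.norm_int_le_one k
  rwa [norm_mul, h1, one_mul] at h3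

theorem lift_padic {p : ℕ} [hp : Fact p.Prime] {n : ℕ} (X : Matrix (Fin n) (Fin n) ℚ)
    (h : ∀ i j, ‖(X i j : ℚ_[p])‖ ≤ 1) :
    ∃ Y : Matrix (Fin n) (Fin n) ℤ_[p], Y.map (PadicInt.Coe.ringHom (p := p)) = X.map (Rat.castHom ℚ_[p]) := by
  refine ⟨Matrix.of fun i j => ⟨X i j, h i j⟩, ?_⟩
  ext i j
  rfl

/-- same genus from a rational p-integral isometry -/
theorem genus_local {b : LinearMap.BilinForm ℚ V} {n : ℕ} {M N : Submodule ℤ V}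
    {β γ : Module.Basis (Fin n) ℚ V} (hβ : ∀ x, x ∈ M ↔ ∀ i, IsZ (β.repr x i))
    (hγ : ∀ x, x ∈ N ↔ ∀ i, IsZ (γ.repr x i)) (hMN : GenEq b M N) {L L' : Matrix (Fin n) (Fin n) ℤ}
    (hL : ∀ i j, (L i j : ℚ) = b (β i) (β j)) (hL' : ∀ i j, (L' i j : ℚ) = b (γ i) (γ j))
    (p : ℕ) [hp : Fact p.Prime] : ∃ U : Matrix (Fin n) (Fin n) ℤ_[p],
    IsUnit U.det ∧ Uᵀ * L.map (Int.cast : ℤ → ℤ_[p]) * U = L'.map (Int.cast : ℤ → ℤ_[p]) := by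
  obtain ⟨g, hg, h1, h2⟩ := hMN p hp.out
  have memM : ∀ j, β j ∈ M := by
    intro j
    rw [hβ]
    intro i
    rw [Module.Basis.repr_self, Finsupp.single_apply]
    split_ifs
    · exact ⟨1, by simp⟩
    · exact ⟨0, by simp⟩
  have memN : ∀ j, γ j ∈ N := by
    intro j
    rw [hγ]
    intro i
    rw [Module.Basis.repr_self, Finsupp.single_apply]
    split_ifs
    · exact ⟨1, by simp⟩
    · exact ⟨0, by simp⟩
  let β' := β.map g
  have i1 : ∀ i j, ‖(β'.toMatrix γ i j : ℚ_[p])‖ ≤ 1 := by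
    intro i j
    obtain ⟨s, hs, hm⟩ := h2 _ (memN j)
    refine padic_integral hs ?_
    have := (hβ _).1 hm i
    rw [zsmul_rat, map_smul, Finsupp.smul_apply, smul_eq_mul] at this
    exact this
  have i2 : ∀ i j, ‖(γ.toMatrix β' i j : ℚ_[p])‖ ≤ 1 := by
    intro i j
    obtain ⟨s, hs, hm⟩ := h1 _ (memM j)
    refine padic_integral hs ?_
    have := (hγ _).1 hm i
    rw [zsmul_rat, map_smul, Finsupp.smul_apply, smul_eq_mul] at this
    rw [Module.Basis.toMatrix_apply, Module.Basis.map_apply]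
    exact this
  obtain ⟨U, hU⟩ := lift_padic _ i1
  obtain ⟨U', hU'⟩ := lift_padic _ i2
  have inj : Function.Injective (fun X : Matrix (Fin n) (Fin n) ℤ_[p] => X.map (PadicInt.Coe.ringHom (p := p))) :=
    Matrix.map_injective Subtype.coe_injective
  have hUU : U * U' = 1 := by
    apply inj
    change (U * U').map _ = (1 : Matrix (Fin n) (Fin n) ℤ_[p]).map _
    rw [Matrix.map_mul, hU, hU', ← Matrix.map_mul, Module.Basis.toMatrix_mul_toMatrix_flip,
      Matrix.map_one _ (map_zero _) (map_one _), Matrix.map_one _ (map_zero _) (map_one _)]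
  have castL : ∀ L : Matrix (Fin n) (Fin n) ℤ, (L.map (Int.cast : ℤ → ℤ_[p])).map (PadicInt.Coe.ringHom (p := p)) =
      (L.map (Int.cast : ℤ → ℚ)).map (Rat.castHom ℚ_[p]) := by
    intro L
    ext i j
    simp
  refine ⟨U, ?_, ?_⟩
  · refine IsUnit.of_mul_eq_one U'.det ?_
    rw [← det_mul, hUU, det_one]
  · apply inj
    change (Uᵀ * L.map (Int.cast : ℤ → ℤ_[p]) * U).map _ = (L'.map (Int.cast : ℤ → ℤ_[p])).map _
    rw [Matrix.map_mul, Matrix.map_mul, transpose_map, hU, castL, castL, ← transpose_map,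
      ← Matrix.map_mul, ← Matrix.map_mul]
    congr 1
    have e1 : L.map (Int.cast : ℤ → ℚ) = Matrix.of fun i j => b (β' i) (β' j) := by
      ext i j
      rw [map_apply, hL, of_apply, Module.Basis.map_apply, Module.Basis.map_apply, hg]
    have e2 : L'.map (Int.cast : ℤ → ℚ) = Matrix.of fun i j => b (γ i) (γ j) := by
      ext i j
      rw [map_apply, hL', of_apply]
    rw [e1, e2, gram_eq]

/-- vectors a multiple of which lies in L -/
def sat (L : Submodule ℤ V) : Submodule ℚ V where
  carrier := {v | ∃ k : ℤ, k ≠ 0 ∧ k • v ∈ L}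
  add_mem' := by
    rintro x y ⟨k, hk, hx⟩ ⟨l, hl, hy⟩
    refine ⟨k * l, mul_ne_zero hk hl, ?_⟩
    rw [smul_add]
    refine L.add_mem ?_ ?_
    · rw [mul_comm, mul_smul]; exact L.smul_mem _ hx
    · rw [mul_smul]; exact L.smul_mem _ hy
  zero_mem' := ⟨1, one_ne_zero, by simp⟩
  smul_mem' := by
    rintro c x ⟨k, hk, hx⟩
    refine ⟨c.den * k, mul_ne_zero (by exact_mod_cast c.den_ne_zero) hk, ?_⟩
    have : ((c.den : ℤ) * k) • c • x = c.num • k • x := by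
      rw [zsmul_rat, zsmul_rat, zsmul_rat, smul_smul, smul_smul]
      congr 1
      push_cast
      have := Rat.mul_den_eq_num c
      linear_combination (k : ℚ) * this
    rw [this]
    exact L.smul_mem _ hx

theorem extend_one {b : LinearMap.BilinForm ℚ V} (hb : ∀ x y, b x y = b y x) {L : Submodule ℤ V}
    (hL : L.FG) (he : EvenL b L) (v : V) :
    ∃ L' : Submodule ℤ V, L ≤ L' ∧ L'.FG ∧ EvenL b L' ∧ v ∈ sat L' := by
  obtain ⟨S, hS⟩ := hL
  set N : ℤ := 2 * (b v v).den * ∏ z ∈ S, ((b z v).den : ℤ) with hN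
  have hprod : (∏ z ∈ S, ((b z v).den : ℤ)) ≠ 0 :=
    Finset.prod_ne_zero_iff.2 fun z _ => by exact_mod_cast (b z v).den_ne_zero
  have hN0 : N ≠ 0 := mul_ne_zero (mul_ne_zero two_ne_zero (by exact_mod_cast (b v v).den_ne_zero)) hprod
  refine ⟨L ⊔ Submodule.span ℤ {N • v}, le_sup_left, ?_, ?_, N, hN0,
    Submodule.mem_sup_right (Submodule.mem_span_singleton_self _)⟩
  · exact Submodule.FG.sup ⟨S, hS⟩ (Submodule.fg_span_singleton _)
  · refine EvenL.sup hb he ?_ ?_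
    · refine ⟨(∏ z ∈ S, ((b z v).den : ℤ)) * (b v v).num * N, ?_⟩
      rw [zsmul_rat]
      simp only [map_smul, LinearMap.smul_apply, smul_eq_mul]
      have := Rat.mul_den_eq_num (b v v)
      have hN' : (N : ℚ) = 2 * (b v v).den * ((∏ z ∈ S, ((b z v).den : ℤ) : ℤ) : ℚ) := by
        rw [hN]; push_cast; ring
      push_cast at hN' ⊢
      rw [← this]
      nth_rewrite 2 [hN']
      ring
    · have : L ≤ cut b ⊤ (N • v) := by
        rw [← hS, Submodule.span_le]
        intro z hz
        refine ⟨trivial, ?_⟩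
        rw [zsmul_rat, map_smul, smul_eq_mul]
        obtain ⟨c, hc⟩ : ((b z v).den : ℤ) ∣ N :=
          (Finset.dvd_prod_of_mem (fun z => ((b z v).den : ℤ)) hz).mul_left _
        refine ⟨c * (b z v).num, ?_⟩
        have h2 := Rat.mul_den_eq_num (b z v)
        have h3 : (N : ℚ) = (b z v).den * c := by exact_mod_cast congrArg (Int.cast : ℤ → ℚ) hc
        push_cast
        rw [h3, ← h2]
        ring
      exact fun z hz => (this hz).2

theorem extend_full [FiniteDimensional ℚ V] {b : LinearMap.BilinForm ℚ V} (hb : ∀ x y, b x y = b y x)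
    {L : Submodule ℤ V} (hL : L.FG) (he : EvenL b L) :
    ∃ L' : Submodule ℤ V, L ≤ L' ∧ IsLat L' ∧ EvenL b L' := by
  classical
  have H : ∀ S : Finset V, ∃ L' : Submodule ℤ V, L ≤ L' ∧ L'.FG ∧ EvenL b L' ∧ ∀ v ∈ S, v ∈ sat L' := by
    intro S
    induction S using Finset.induction_on with
    | empty => exact ⟨L, le_rfl, hL, he, by simp⟩
    | insert v S _ IH =>
      obtain ⟨L', h1, h2, h3, h4⟩ := IH
      obtain ⟨L'', g1, g2, g3, g4⟩ := extend_one hb h2 h3 v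
      refine ⟨L'', h1.trans g1, g2, g3, fun w hw => ?_⟩
      rcases Finset.mem_insert.1 hw with rfl | hw
      · exact g4
      · obtain ⟨k, hk, hkw⟩ := h4 w hw
        exact ⟨k, hk, g1 hkw⟩
  obtain ⟨S, hS⟩ := (Module.finite_def (R := ℚ) (M := V)).1 inferInstance
  obtain ⟨L', h1, h2, h3, h4⟩ := H S
  refine ⟨L', h1, ⟨h2, fun v => ?_⟩, h3⟩
  have : (⊤ : Submodule ℚ V) ≤ sat L' := by
    rw [← hS, Submodule.span_le]
    exact h4
  exact this (Submodule.mem_top (x := v))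
end lat
end Bur

namespace Bur

theorem int_quad_cast {R : Type*} [CommRing R] {m : ℕ} (M : Matrix (Fin m) (Fin m) ℤ) (z : Fin m → ℤ) :
    (fun i => (z i : R)) ⬝ᵥ M.map (Int.cast : ℤ → R) *ᵥ (fun i => (z i : R)) =
      ((z ⬝ᵥ M *ᵥ z : ℤ) : R) := by
  simp only [dotProduct, mulVec, map_apply]
  push_cast
  rfl

theorem clear_den {m : ℕ} (x : Fin m → ℚ) :
    ∃ k : ℤ, k ≠ 0 ∧ ∃ z : Fin m → ℤ, ∀ i, (k : ℚ) * x i = z i := by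
  refine ⟨∏ i, ((x i).den : ℤ), Finset.prod_ne_zero_iff.2 fun i _ => by exact_mod_cast (x i).den_ne_zero, ?_⟩
  have : ∀ i, ∃ c : ℤ, ((∏ i, ((x i).den : ℤ) : ℤ) : ℚ) * x i = c := by
    intro i
    obtain ⟨c, hc⟩ : ((x i).den : ℤ) ∣ ∏ i, ((x i).den : ℤ) :=
      Finset.dvd_prod_of_mem (fun i => ((x i).den : ℤ)) (Finset.mem_univ i)
    refine ⟨c * (x i).num, ?_⟩
    rw [hc]
    push_cast
    rw [← Rat.mul_den_eq_num (x i)]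
    ring
  choose z hz using this
  exact ⟨z, hz⟩

theorem pd_of_int {m : ℕ} {M : Matrix (Fin m) (Fin m) ℤ} (h : IsPDForm M) :
    PD (M.map (Int.cast : ℤ → ℚ)) := by
  refine ⟨h.1.map _, fun x hx => ?_⟩
  obtain ⟨k, hk, z, hz⟩ := clear_den x
  have hkq : (k : ℚ) ≠ 0 := by exact_mod_cast hk
  have hz0 : z ≠ 0 := by
    rintro rfl
    apply hx
    funext i
    have := hz i
    simpa [hk] using this
  have h1 := h.2 z hz0
  have h2 : ((z ⬝ᵥ M *ᵥ z : ℤ) : ℚ) = k ^ 2 * (x ⬝ᵥ M.map (Int.cast : ℤ → ℚ) *ᵥ x) := by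
    rw [← int_quad_cast]
    have : (fun i => (z i : ℚ)) = (k : ℚ) • x := by
      funext i
      rw [← hz i]; rfl
    rw [this, mulVec_smul, smul_dotProduct, dotProduct_smul]
    simp only [smul_eq_mul]
    ring
  have h3 : (0 : ℚ) < ((z ⬝ᵥ M *ᵥ z : ℤ) : ℚ) := by exact_mod_cast h1
  rw [h2] at h3
  exact pos_of_mul_pos_right h3 (sq_nonneg _)

theorem loc_of_buried {m n : ℕ} {ℓ₁ ℓ₂ : Matrix (Fin m) (Fin m) ℤ}
    (h : ∀ (p : ℕ) [Fact p.Prime], BuriedIn ℚ_[p] n ℓ₁ ℓ₂) :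
    Loc n (ℓ₁.map (Int.cast : ℤ → ℚ)) (ℓ₂.map (Int.cast : ℤ → ℚ)) := by
  intro p hp
  obtain ⟨L, -, -, ⟨S, hS⟩, S', hS'⟩ := h p
  let f : ((Fin m → ℚ_[p]) × (Fin m → ℚ_[p])) →ₗ[ℚ_[p]] (Fin n → ℚ_[p]) :=
    S.mulVecLin.coprod (-S'.mulVecLin)
  have cast : ∀ M : Matrix (Fin m) (Fin m) ℤ, (M.map (Int.cast : ℤ → ℚ)).map (Rat.cast : ℚ → ℚ_[p]) =
      M.map (Int.cast : ℤ → ℚ_[p]) := by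
    intro M; ext i j; simp
  refine ⟨LinearMap.ker f, ?_, ?_⟩
  · have h1 := f.finrank_range_add_finrank_ker
    have h2 := Submodule.finrank_le (LinearMap.range f)
    rw [Module.finrank_prod, Module.finrank_fin_fun] at h1
    rw [Module.finrank_fin_fun] at h2
    omega
  · intro z hz
    have hz' : S *ᵥ z.1 = S' *ᵥ z.2 := by
      have := LinearMap.mem_ker.1 hz
      simp only [f, LinearMap.coprod_apply, LinearMap.neg_apply, mulVecLin_apply] at this
      exact add_neg_eq_zero.1 this
    rw [cast, cast, ← hS, ← hS', quad_transport, quad_transport, hz']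

theorem cast_rep {R : Type*} [CommRing R] {n m : ℕ} {L : Matrix (Fin n) (Fin n) ℤ}
    {N : Matrix (Fin m) (Fin m) ℤ} {T : Matrix (Fin n) (Fin m) ℤ} (h : Tᵀ * L * T = N) :
    (T.map (Int.cast : ℤ → R))ᵀ * L.map (Int.cast : ℤ → R) * T.map (Int.cast : ℤ → R) =
      N.map (Int.cast : ℤ → R) := by
  rw [← h]
  change _ = (Tᵀ * L * T).map (Int.castRingHom R)
  rw [Matrix.map_mul, Matrix.map_mul]
  rfl

theorem backward {m n : ℕ} {ℓ₁ ℓ₂ : Matrix (Fin m) (Fin m) ℤ} {L L' : Matrix (Fin n) (Fin n) ℤ}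
    (hL : IsPDForm L) (hg : SameGenus L L') (h₁ : Represents L ℓ₁) (h₂ : Represents L' ℓ₂)
    (p : ℕ) [Fact p.Prime] : BuriedIn ℚ_[p] n ℓ₁ ℓ₂ := by
  obtain ⟨T, hT⟩ := h₁
  obtain ⟨T', hT'⟩ := h₂
  obtain ⟨U, -, hU⟩ := hg p
  refine ⟨L.map (Int.cast : ℤ → ℚ_[p]), hL.1.map _, ?_, ⟨_, cast_rep hT⟩,
    U.map (PadicInt.Coe.ringHom (p := p)) * T'.map (Int.cast : ℤ → ℚ_[p]), ?_⟩
  · have h1 : (L.map (Int.cast : ℤ → ℚ_[p])).det = ((L.det : ℤ) : ℚ_[p]) :=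
      ((Int.castRingHom ℚ_[p]).map_det L).symm
    rw [h1]
    intro h0
    have h0' : L.det = 0 := by exact_mod_cast h0
    obtain ⟨v, hv, hv0⟩ := Matrix.exists_mulVec_eq_zero_iff.2 h0'
    have := hL.2 v hv
    rw [hv0, dotProduct_zero] at this
    exact lt_irrefl _ this
  · have h1 : (U.map (PadicInt.Coe.ringHom (p := p)))ᵀ * L.map (Int.cast : ℤ → ℚ_[p]) *
        U.map (PadicInt.Coe.ringHom (p := p)) = L'.map (Int.cast : ℤ → ℚ_[p]) := by
      have := congrArg (fun X => X.map (PadicInt.Coe.ringHom (p := p))) hU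
      have cast : ∀ M : Matrix (Fin n) (Fin n) ℤ,
          (M.map (Int.cast : ℤ → ℤ_[p])).map (PadicInt.Coe.ringHom (p := p)) =
          M.map (Int.cast : ℤ → ℚ_[p]) := by
        intro M; ext i j; simp
      rwa [Matrix.map_mul, Matrix.map_mul, transpose_map, cast, cast] at this
    rw [← cast_rep hT', ← h1, transpose_mul]
    simp only [Matrix.mul_assoc]

section fwd
variable {V : Type*} [AddCommGroup V] [Module ℚ V]

theorem rep_of {n m : ℕ} {b : LinearMap.BilinForm ℚ V} {M : Submodule ℤ V} {β : Module.Basis (Fin n) ℚ V}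
    (hβ : ∀ x, x ∈ M ↔ ∀ i, IsZ (β.repr x i)) {L : Matrix (Fin n) (Fin n) ℤ}
    (hL : ∀ i j, (L i j : ℚ) = b (β i) (β j)) {N : Matrix (Fin m) (Fin m) ℤ} (u : Fin m → V)
    (hu : ∀ j, u j ∈ M) (hN : ∀ i j, (N i j : ℚ) = b (u i) (u j)) : Represents L N := by
  have := fun i j => (hβ _).1 (hu j) i
  choose T hT using this
  refine ⟨Matrix.of T, ?_⟩
  have inj : Function.Injective (fun X : Matrix (Fin m) (Fin m) ℤ => X.map (Int.cast : ℤ → ℚ)) :=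
    Matrix.map_injective Int.cast_injective
  apply inj
  change (_ : Matrix _ _ ℤ).map (Int.cast : ℤ → ℚ) = N.map (Int.cast : ℤ → ℚ)
  rw [← cast_rep rfl]
  have e1 : (Matrix.of T).map (Int.cast : ℤ → ℚ) = β.toMatrix u := by
    ext i j
    rw [map_apply, of_apply, ← hT]; rfl
  have e2 : L.map (Int.cast : ℤ → ℚ) = Matrix.of fun i j => b (β i) (β j) := by
    ext i j; rw [map_apply, hL, of_apply]
  have e3 : N.map (Int.cast : ℤ → ℚ) = Matrix.of fun i j => b (u i) (u j) := by
    ext i j; rw [map_apply, hN, of_apply]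
  rw [e1, e2, e3, gram_eq]

theorem gram_exists {n : ℕ} {b : LinearMap.BilinForm ℚ V} (hb : ∀ x y, b x y = b y x)
    (hpos : ∀ x, x ≠ 0 → 0 < b x x) {M : Submodule ℤ V} (he : EvenL b M) {β : Module.Basis (Fin n) ℚ V}
    (hβ : ∀ x, x ∈ M ↔ ∀ i, IsZ (β.repr x i)) :
    ∃ L : Matrix (Fin n) (Fin n) ℤ, (∀ i j, (L i j : ℚ) = b (β i) (β j)) ∧ IsPDForm L := by
  have memM : ∀ j, β j ∈ M := by
    intro j
    rw [hβ]
    intro i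
    rw [Module.Basis.repr_self, Finsupp.single_apply]
    split_ifs
    · exact ⟨1, by simp⟩
    · exact ⟨0, by simp⟩
  have := fun i j => EvenL.isZ hb he (memM i) (memM j)
  choose L hL using this
  refine ⟨Matrix.of L, fun i j => (hL i j).symm, ?_, fun x hx => ?_⟩
  · ext i j
    have : (L j i : ℚ) = L i j := by rw [← hL, ← hL, hb]
    exact_mod_cast this
  · have h1 : ∑ i, (x i : ℚ) • β i ≠ 0 := by
      intro h0
      apply hx
      funext i
      have := Fintype.linearIndependent_iff.1 β.linearIndependent _ h0 i
      exact_mod_cast this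
    have h2 := hpos _ h1
    have h3 : b (∑ i, (x i : ℚ) • β i) (∑ i, (x i : ℚ) • β i) = ((x ⬝ᵥ (Matrix.of L) *ᵥ x : ℤ) : ℚ) := by
      simp only [map_sum, LinearMap.sum_apply, map_smul, LinearMap.smul_apply, smul_eq_mul, dotProduct,
        mulVec, of_apply, hL, Finset.mul_sum]
      push_cast
      rw [Finset.sum_comm]
      refine Finset.sum_congr rfl fun i _ => Finset.sum_congr rfl fun j _ => by ring
    rw [h3] at h2
    exact_mod_cast h2

theorem start_lat {ι : Type} [Fintype ι] [DecidableEq ι] {m : ℕ} {d : ι → ℚ} {S : Matrix ι (Fin m) ℚ}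
    {N : Matrix (Fin m) (Fin m) ℤ} (hS : Sᵀ * diagonal d * S = N.map (Int.cast : ℤ → ℚ))
    (he : IsEvenForm N) : ∃ L : Submodule ℤ (ι → ℚ), L.FG ∧ EvenL (Matrix.toBilin' (diagonal d)) L ∧
      ∀ j, S *ᵥ Pi.single j 1 ∈ L := by
  let f : (Fin m → ℤ) →ₗ[ℤ] (ι → ℚ) :=
    (S.mulVecLin.restrictScalars ℤ).comp (LinearMap.compLeft (Algebra.linearMap ℤ ℚ) (Fin m))
  have hf : ∀ z, f z = S *ᵥ (fun i => (z i : ℚ)) := by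
    intro z; rfl
  refine ⟨LinearMap.range f, ?_, ?_, ?_⟩
  · rw [← Submodule.map_top]
    exact Submodule.FG.map _ Module.Finite.fg_top
  · rintro _ ⟨z, rfl⟩
    obtain ⟨k, hk⟩ := he z
    refine ⟨k, ?_⟩
    rw [hf, Matrix.toBilin'_apply', ← quad_transport, hS, int_quad_cast, hk]
    push_cast
    rfl
  · intro j
    refine ⟨Pi.single j 1, ?_⟩
    rw [hf]
    congr 1
    funext i
    rw [Pi.single_apply, Pi.single_apply]
    split_ifs <;> simp

theorem bil_entry {ι : Type} [Fintype ι] [DecidableEq ι] {m : ℕ} {d : ι → ℚ} {S : Matrix ι (Fin m) ℚ}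
    {N : Matrix (Fin m) (Fin m) ℤ} (hS : Sᵀ * diagonal d * S = N.map (Int.cast : ℤ → ℚ)) (i j : Fin m) :
    (N i j : ℚ) = Matrix.toBilin' (diagonal d) (S *ᵥ Pi.single i 1) (S *ᵥ Pi.single j 1) := by
  have := congrFun (congrFun hS i) j
  rw [map_apply] at this
  rw [← this, Matrix.toBilin'_apply']
  simp only [mulVec_single_one]
  rw [Matrix.mul_assoc, Matrix.mul_apply]
  simp only [dotProduct, mulVec, Matrix.mul_apply]
  rfl

end fwd

theorem forward {m n : ℕ} (hmn : m ≤ n) {ℓ₁ ℓ₂ : Matrix (Fin m) (Fin m) ℤ}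
    (h₁ : IsPDForm ℓ₁) (h₂ : IsPDForm ℓ₂) (he₁ : IsEvenForm ℓ₁) (he₂ : IsEvenForm ℓ₂)
    (h : ∀ (p : ℕ) [Fact p.Prime], BuriedIn ℚ_[p] n ℓ₁ ℓ₂) :
    ∃ L L' : Matrix (Fin n) (Fin n) ℤ, IsPDForm L ∧ IsPDForm L' ∧ SameGenus L L' ∧
        Represents L ℓ₁ ∧ Represents L' ℓ₂ := by
  obtain ⟨ι, _, _, d, S₁, S₂, hcard, hd, hS₁, hS₂⟩ := W hmn (pd_of_int h₁) (pd_of_int h₂) (loc_of_buried h)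
  let b : LinearMap.BilinForm ℚ (ι → ℚ) := Matrix.toBilin' (diagonal d)
  have hb : ∀ x y, b x y = b y x := by
    intro x y
    simp only [b, Matrix.toBilin'_apply', dotProduct, mulVec_diagonal]
    exact Finset.sum_congr rfl fun i _ => by ring
  have hpos : ∀ x, x ≠ 0 → 0 < b x x := by
    intro x hx
    simp only [b, Matrix.toBilin'_apply']
    rw [diag_quad]
    obtain ⟨i, hi⟩ := Function.ne_iff.1 hx
    refine Finset.sum_pos' (fun j _ => mul_nonneg (hd j).le (sq_nonneg _)) ⟨i, Finset.mem_univ i, ?_⟩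
    exact mul_pos (hd i) (by have : x i ≠ 0 := hi; positivity)
  have hn : Module.finrank ℚ (ι → ℚ) = n := by rw [Module.finrank_fintype_fun_eq_card, hcard]
  obtain ⟨K₁, fg₁, ev₁, mem₁⟩ := start_lat hS₁ he₁
  obtain ⟨K₂, fg₂, ev₂, mem₂⟩ := start_lat hS₂ he₂
  obtain ⟨L₁, k₁, lat₁, evl₁⟩ := extend_full hb fg₁ ev₁
  obtain ⟨L₂, k₂, lat₂, evl₂⟩ := extend_full hb fg₂ ev₂
  obtain ⟨M₁, M₂, l₁, l₂, la₁, la₂, e₁, e₂, hg⟩ := same_genus_over hb lat₂ evl₂ L₁ lat₁ evl₁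
  obtain ⟨β, hβ⟩ := exists_adapted_basis hn la₁
  obtain ⟨γ, hγ⟩ := exists_adapted_basis hn la₂
  obtain ⟨L, hL, pL⟩ := gram_exists hb hpos e₁ hβ
  obtain ⟨L', hL', pL'⟩ := gram_exists hb hpos e₂ hγ
  exact ⟨L, L', pL, pL', fun p _ => genus_local hβ hγ hg hL hL' p,
    rep_of hβ hL _ (fun j => l₁ (k₁ (mem₁ j))) (bil_entry hS₁),
    rep_of hγ hL' _ (fun j => l₂ (k₂ (mem₂ j))) (bil_entry hS₂)⟩

end Bur

/-- For even positive definite forms ℓ₁, ℓ₂ of rank m ≤ n: the pair is buried in rank n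
over ℚ_p for every prime p iff it is buried in a genus of rank n. -/
theorem buried_locally_iff_buried_in_genus (m n : ℕ) (hm : 0 < m) (hmn : m ≤ n)
    (ℓ₁ ℓ₂ : Matrix (Fin m) (Fin m) ℤ)
    (h₁ : IsPDForm ℓ₁) (h₂ : IsPDForm ℓ₂)
    (he₁ : IsEvenForm ℓ₁) (he₂ : IsEvenForm ℓ₂) :
    (∀ (p : ℕ) [Fact p.Prime], BuriedIn ℚ_[p] n ℓ₁ ℓ₂) ↔
      ∃ L L' : Matrix (Fin n) (Fin n) ℤ, IsPDForm L ∧ IsPDForm L' ∧ SameGenus L L' ∧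
        Represents L ℓ₁ ∧ Represents L' ℓ₂ := by
  constructor
  · exact fun h => Bur.forward hmn h₁ h₂ he₁ he₂ h
  · rintro ⟨L, L', hL, -, hg, r₁, r₂⟩ p _
    exact Bur.backward hL hg r₁ r₂ p
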